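/- For all integers N ≥ 0 and n ≥ 1, the remainder after an odd number of terms satisfies c_{2N+1}/n^{N+1/2} − exp(−(π/2)√(2n/3)) < R_{2N+1}(n) < exp(−(π/2)√(2n/3)). -/

import Mathlib

open Real Finset Filter Topology

noncomputable def c (m : ℕ) : ℝ :=
  ((-1 : ℝ) ^ m / (4 * Real.sqrt 6) ^ m) *
    ∑ k ∈ Finset.range ((m + 1) / 2 + 1),
      ((m + 1).choose k : ℝ) * ((m + 1 - k : ℕ) : ℝ) / ((m + 1 - 2 * k).factorial : ℝ) *
        (π / 6) ^ ((m : ℤ) - 2 * k)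

/-- The number of partitions of `n`, as a real number. -/
noncomputable def p (n : ℕ) : ℝ := (Fintype.card (Nat.Partition n) : ℝ)

/-- The remainder after `N` terms of the asymptotic expansion. -/
noncomputable def R (N n : ℕ) : ℝ :=
  4 * Real.sqrt 3 * (n : ℝ) * Real.exp (-(π * Real.sqrt (2 * n / 3))) * p n -
    ∑ m ∈ Finset.range N, c m / (n : ℝ) ^ ((m : ℝ) / 2)

section PartitionSeries

open PowerSeries in
/-- Euler's product formula in the form `(∑ p(n) Xⁿ) ∏ (1 - Xⁱ) = 1`, the product being expanded by
the pentagonal number theorem. -/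
lemma mk_card_partition_mul_pentagonalSeries (A : Type*) [CommRing A] :
    PowerSeries.mk (fun n ↦ (Fintype.card (Nat.Partition n) : A)) * pentagonalSeries A = 1 := by
  let _ : TopologicalSpace A := ⊥
  have _ : DiscreteTopology A := ⟨rfl⟩
  open scoped PowerSeries.WithPiTopology in
  have h1 := (Nat.Partition.hasProd_genFun (R := A) (fun _ _ ↦ 1)).mul
    (WithPiTopology.hasProd_one_sub_X_pow A)
  have h2 : Nat.Partition.genFun (R := A) (fun _ _ ↦ 1) =
      PowerSeries.mk (fun n ↦ (Fintype.card (Nat.Partition n) : A)) := by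
    ext n
    simp [Finsupp.prod]
  rw [h2] at h1
  refine h1.unique ?_
  convert hasProd_one with i
  open scoped PowerSeries.WithPiTopology in
  have hs : Summable fun j : ℕ ↦ (X : A⟦X⟧) ^ ((i + 1) * (j + 1)) := by
    simpa using Nat.Partition.summable_genFun_term (R := A) (fun _ _ ↦ 1) i
  have e : (X : A⟦X⟧) ^ (i + 1) * (1 + ∑' j : ℕ, (X : A⟦X⟧) ^ ((i + 1) * (j + 1))) =
      ∑' j : ℕ, (X : A⟦X⟧) ^ ((i + 1) * (j + 1)) := by
    conv_rhs => rw [hs.tsum_eq_zero_add]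
    rw [mul_add, ← hs.tsum_mul_left]
    simp only [mul_one, zero_add, ← pow_add]
    congr 2
    ext1 j
    ring_nf
  simp only [one_smul]
  linear_combination -e

lemma card_partition_le_two_pow (n : ℕ) : Fintype.card (Nat.Partition n) ≤ 2 ^ n :=
  ((Fintype.card_le_of_surjective _ Nat.Partition.ofComposition_surj).trans
    (composition_card n).le).trans (Nat.pow_le_pow_right (by norm_num) (by omega))

open PowerSeries in
lemma tprod_one_sub_pow_eq_tsum_pentagonal {q : ℂ} (hq : ‖q‖ < 1 / 4) :
    HasSum (fun n ↦ (pentagonalSeries ℂ).coeff n * q ^ n) (∏' n : ℕ, (1 - q ^ (n + 1))) := by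
  have hq1 : ‖q‖ < 1 := by linarith
  have h1 : Summable fun n : ℕ ↦ ‖q‖ ^ n := summable_geometric_of_lt_one (norm_nonneg _) hq1
  have hcoef : ∀ n, ‖(pentagonalSeries ℂ).coeff n‖ ≤ 1 := by
    intro n
    by_cases h : n ∈ Set.range pentagonal
    · obtain ⟨k, rfl⟩ := h
      rw [coeff_pentagonalSeries_pentagonal]
      rcases Int.even_or_odd k with hk | hk
      · simp [Int.negOnePow_even k hk]
      · simp [Int.negOnePow_odd k hk]
    · simp [coeff_pentagonalSeries_eq_zero ℂ h]
  have hsum : Summable (fun n ↦ (pentagonalSeries ℂ).coeff n * q ^ n) := by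
    refine Summable.of_norm_bounded h1 fun n ↦ ?_
    rw [norm_mul, norm_pow]
    exact mul_le_of_le_one_left (by positivity) (hcoef n)
  have h2 := hsum.hasSum
  rw [← pentagonal_injective.hasSum_iff
    (fun n hn ↦ by simp [coeff_pentagonalSeries_eq_zero ℂ hn])] at h2
  rw [← neg_injective.hasSum_iff (fun x hx ↦ by absurd hx; use -x; simp)] at h2
  have h3 := h2.nat_add_neg_add_one
  have h4 : HasSum (fun k : ℕ ↦ (-1 : ℂ) ^ k * (q ^ pentagonal (-k) - q ^ pentagonal (k + 1)))
      (∑' n, (pentagonalSeries ℂ).coeff n * q ^ n) := by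
    convert h3 using 2 with k
    simp_rw [Function.comp_apply, coeff_pentagonalSeries_pentagonal, neg_neg, Int.negOnePow_add]
    simp
    ring
  have hg : Summable fun n : ℕ ↦ 2 * (2 * ‖q‖) ^ n :=
    (summable_geometric_of_lt_one (by positivity) (by linarith)).mul_left 2
  have hb : ∀ k n : ℕ, ‖q ^ ((k + 1) * n) * ∏ i ∈ Finset.range (n + 1), (1 - q ^ (k + i + 1))‖ ≤
      2 * (2 * ‖q‖) ^ n := by
    intro k n
    rw [norm_mul, norm_pow, norm_prod]
    have e1 : ‖q‖ ^ ((k + 1) * n) ≤ ‖q‖ ^ n :=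
      pow_le_pow_of_le_one (norm_nonneg _) hq1.le (by nlinarith)
    have e2 : ∏ i ∈ Finset.range (n + 1), ‖1 - q ^ (k + i + 1)‖ ≤
        ∏ i ∈ Finset.range (n + 1), 2 := by
      refine Finset.prod_le_prod (fun _ _ ↦ norm_nonneg _) fun i _ ↦ ?_
      refine (norm_sub_le _ _).trans ?_
      rw [norm_one, norm_pow]
      have := pow_le_one₀ (n := k + i + 1) (norm_nonneg q) hq1.le
      linarith
    calc _ ≤ ‖q‖ ^ n * ∏ i ∈ Finset.range (n + 1), 2 := by
            gcongr
      _ = _ := by simp [mul_pow, pow_succ]; ring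
  rw [Pentagonal.tprod_one_sub_pow (x := q)
    (tendsto_pow_atTop_nhds_zero_of_norm_lt_one hq1)
    (fun k ↦ Summable.of_norm_bounded hg (hb k)) ?_ h4.summable ?_, h4.tsum_eq]
  · exact hsum.hasSum
  · intro k
    have h5 : Summable fun n : ℕ ↦ ‖-q ^ (n + k + 1)‖ := by
      simpa [add_assoc] using (summable_nat_add_iff (k + 1)).mpr h1
    simpa [sub_eq_add_neg] using multipliable_one_add_of_summable h5
  · have h7 : Tendsto (fun k : ℕ ↦ ‖q‖ ^ k * ∑' n : ℕ, 2 * (2 * ‖q‖) ^ n) atTop (𝓝 0) := by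
      simpa using (tendsto_pow_atTop_nhds_zero_of_lt_one (norm_nonneg q) hq1).mul_const
        (∑' n : ℕ, 2 * (2 * ‖q‖) ^ n)
    refine squeeze_zero_norm (fun k ↦ ?_) h7
    rw [norm_mul, norm_mul, norm_pow, norm_pow, norm_neg, norm_one, one_pow, one_mul]
    refine mul_le_mul ?_ (tsum_of_norm_bounded hg.hasSum (hb k)) (norm_nonneg _) (by positivity)
    refine pow_le_pow_of_le_one (norm_nonneg _) hq1.le ?_
    rw [Nat.le_div_iff_mul_le (by norm_num)]
    nlinarith

lemma hasSum_card_partition {q : ℂ} (hq : ‖q‖ < 1 / 4) :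
    HasSum (fun n ↦ (p n : ℂ) * q ^ n) (∏' n : ℕ, (1 - q ^ (n + 1)))⁻¹ := by
  have h1 : Summable fun n : ℕ ↦ ‖(p n : ℂ) * q ^ n‖ := by
    have : Summable fun n : ℕ ↦ (2 * ‖q‖) ^ n :=
      summable_geometric_of_lt_one (by positivity) (by linarith)
    refine Summable.of_nonneg_of_le (fun _ ↦ norm_nonneg _) (fun n ↦ ?_) this
    rw [norm_mul, norm_pow, mul_pow]
    gcongr
    rw [p, Complex.ofReal_natCast, Complex.norm_natCast]
    exact_mod_cast card_partition_le_two_pow n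
  have h2 := tprod_one_sub_pow_eq_tsum_pentagonal hq
  have h3 := tsum_mul_tsum_eq_tsum_sum_antidiagonal_of_summable_norm h1 h2.summable.norm
  have h4 : ∀ n, ∑ kl ∈ antidiagonal n, (p kl.1 : ℂ) * q ^ kl.1 *
      ((PowerSeries.pentagonalSeries ℂ).coeff kl.2 * q ^ kl.2) = if n = 0 then 1 else 0 := by
    intro n
    have := congrArg (PowerSeries.coeff n) (mk_card_partition_mul_pentagonalSeries ℂ)
    rw [PowerSeries.coeff_mul, PowerSeries.coeff_one] at this
    have e : ∀ kl ∈ antidiagonal n, (p kl.1 : ℂ) * q ^ kl.1 *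
        ((PowerSeries.pentagonalSeries ℂ).coeff kl.2 * q ^ kl.2) = q ^ n *
        ((PowerSeries.mk fun n ↦ (Fintype.card (Nat.Partition n) : ℂ)).coeff kl.1 *
          (PowerSeries.pentagonalSeries ℂ).coeff kl.2) := by
      intro kl hkl
      rw [← mem_antidiagonal.mp hkl, pow_add, PowerSeries.coeff_mk, p, Complex.ofReal_natCast]
      ring
    rw [Finset.sum_congr rfl e, ← Finset.mul_sum, this]
    split_ifs with h <;> simp [h]
  rw [tsum_congr h4, tsum_ite_eq, h2.tsum_eq] at h3
  rw [← eq_inv_of_mul_eq_one_left h3]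
  exact h1.of_norm.hasSum

end PartitionSeries

section PartitionIntegral
open ModularForm MeasureTheory

/-- The coefficient of `qⁿ` in `∏ (1 - qⁱ)⁻¹` times `q⁻ⁿ`, as a function on the upper half plane,
expressed through the Dedekind eta function. -/
noncomputable def partitionIntegrand (n : ℕ) (τ : ℂ) : ℂ :=
  Complex.exp (-(2 * π * Complex.I * (n - 1 / 24) * τ)) / η τ

lemma partitionIntegrand_eq (n : ℕ) (τ : ℂ) :
    partitionIntegrand n τ = Complex.exp (-(2 * π * Complex.I * n * τ)) *
      (∏' k : ℕ, (1 - Complex.exp (2 * π * Complex.I * τ) ^ (k + 1)))⁻¹ := by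
  rw [partitionIntegrand, eta, div_eq_mul_inv, mul_inv, ← mul_assoc]
  simp_rw [eta_q_eq_pow]
  congr 1
  rw [Function.Periodic.qParam, ← Complex.exp_neg, ← Complex.exp_add]
  congr 1
  push_cast
  ring

lemma partitionIntegrand_add_one (n : ℕ) (τ : ℂ) :
    partitionIntegrand n (τ + 1) = partitionIntegrand n τ := by
  have h1 : Complex.exp (2 * π * Complex.I * (τ + 1)) = Complex.exp (2 * π * Complex.I * τ) := by
    rw [mul_add, mul_one, Complex.exp_add, Complex.exp_two_pi_mul_I, mul_one]
  have h2 : Complex.exp (-(2 * π * Complex.I * n * (τ + 1))) =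
      Complex.exp (-(2 * π * Complex.I * n * τ)) := by
    rw [show -(2 * π * Complex.I * n * (τ + 1)) =
      -(2 * π * Complex.I * n * τ) - n * (2 * π * Complex.I) by ring, Complex.exp_sub,
      Complex.exp_nat_mul_two_pi_mul_I, div_one]
  rw [partitionIntegrand_eq, partitionIntegrand_eq, h1, h2]

lemma differentiableOn_inv_tprod_one_sub_pow :
    DifferentiableOn ℂ (fun q : ℂ ↦ (∏' k : ℕ, (1 - q ^ (k + 1)))⁻¹) (Metric.ball 0 1) := by
  refine differentiableOn_tprod_one_sub_pow.inv fun q hq ↦ ?_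
  have hq' : ‖q‖ < 1 := by simpa using hq
  simp_rw [sub_eq_add_neg]
  refine tprod_one_add_ne_zero_of_summable (fun k h ↦ ?_) ?_
  · have h1 : q ^ (k + 1) = 1 := by linear_combination -h
    have h2 := pow_lt_one₀ (norm_nonneg q) hq' k.succ_ne_zero
    rw [← norm_pow, h1, norm_one] at h2
    exact lt_irrefl _ h2
  · simpa using (summable_nat_add_iff 1).mpr (summable_geometric_of_lt_one (norm_nonneg _) hq')

lemma continuousOn_partitionIntegrand (n : ℕ) :
    ContinuousOn (partitionIntegrand n) {τ | 0 < τ.im} := by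
  unfold partitionIntegrand
  refine ContinuousOn.div (by fun_prop) (fun τ hτ ↦ ?_) fun τ hτ ↦ eta_ne_zero hτ
  exact (differentiableAt_eta_of_mem_upperHalfPlaneSet hτ).continuousAt.continuousWithinAt

/-- Cauchy's formula for the partition numbers on a horizontal segment of length one. -/
lemma p_eq_intervalIntegral (n : ℕ) {y : ℝ} (hy : 0 < y) (x₀ : ℝ) :
    (p n : ℂ) = ∫ x in x₀..x₀ + 1, partitionIntegrand n (x + y * Complex.I) := by
  set f : ℂ → ℂ := fun q ↦ (∏' k : ℕ, (1 - q ^ (k + 1)))⁻¹ with hf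
  obtain ⟨r, hr⟩ : ∃ r : NNReal, (r : ℝ) = rexp (-(2 * π * y)) :=
    ⟨⟨_, (exp_pos _).le⟩, rfl⟩
  have hr0 : 0 < r := by
    rw [← NNReal.coe_pos, hr]
    exact exp_pos _
  have hr1 : (r : ℝ) < 1 := by
    rw [hr, exp_lt_one_iff]
    nlinarith [mul_pos pi_pos hy]
  have hd : DifferentiableOn ℂ f (Metric.closedBall 0 r) :=
    differentiableOn_inv_tprod_one_sub_pow.mono (Metric.closedBall_subset_ball hr1)
  have h1 := (hd.hasFPowerSeriesOnBall hr0).hasFPowerSeriesAt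
  have h2 : HasFPowerSeriesAt f (FormalMultilinearSeries.ofScalars ℂ fun n ↦ (p n : ℂ)) 0 := by
    rw [hasFPowerSeriesAt_iff]
    filter_upwards [Metric.ball_mem_nhds (0 : ℂ) (show (0 : ℝ) < 1 / 4 by norm_num)] with z hz
    have := hasSum_card_partition (q := z) (by simpa using hz)
    simpa [hf, FormalMultilinearSeries.coeff_ofScalars, mul_comm] using this
  have h3 := congrArg (fun s ↦ s.coeff n) (h1.eq_formalMultilinearSeries h2)
  simp only [FormalMultilinearSeries.coeff_ofScalars] at h3
  have hper : Function.Periodic (fun x : ℝ ↦ partitionIntegrand n (x + y * Complex.I)) 1 := by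
    intro x
    simp only
    rw [← partitionIntegrand_add_one n (x + y * Complex.I)]
    congr 1
    push_cast
    ring
  have h4 := hper.intervalIntegral_add_eq x₀ 0
  have h6 : (cauchyPowerSeries f 0 r).coeff n = (2 * π * Complex.I)⁻¹ •
      ∮ z in C(0, r), ((1 : ℂ) / (z - 0)) ^ n • (z - 0)⁻¹ • f z :=
    cauchyPowerSeries_apply f 0 r n 1
  rw [h4, ← h3, h6]
  simp only [circleIntegral, zero_add]
  have h5 := intervalIntegral.smul_integral_comp_mul_left (a := 0) (b := 1)
    (fun θ ↦ deriv (circleMap 0 r) θ • (1 / (circleMap 0 r θ - 0)) ^ n •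
      (circleMap 0 r θ - 0)⁻¹ • f (circleMap 0 r θ)) (2 * π)
  simp only [mul_zero, mul_one] at h5
  have h7 : ∀ x : ℝ, circleMap 0 r (2 * π * x) =
      Complex.exp (2 * π * Complex.I * (x + y * Complex.I)) := by
    intro x
    simp only [circleMap, hr, zero_add, Complex.ofReal_exp]
    rw [← Complex.exp_add]
    congr 1
    push_cast
    linear_combination (-2 * (π : ℂ) * y) * Complex.I_sq
  rw [← h5, ← intervalIntegral.integral_smul, ← intervalIntegral.integral_smul]
  congr 1
  ext x
  simp only [h7, deriv_circleMap, sub_zero, smul_eq_mul, partitionIntegrand_eq, hf]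
  rw [one_div, ← Complex.exp_neg, ← Complex.exp_nat_mul, Complex.real_smul,
    show (n : ℂ) * -(2 * π * Complex.I * (x + y * Complex.I)) =
      -(2 * π * Complex.I * n * (x + y * Complex.I)) by ring]
  have := Complex.exp_ne_zero (2 * π * Complex.I * (x + y * Complex.I))
  have hpi : (π : ℂ) ≠ 0 := by exact_mod_cast pi_ne_zero
  push_cast
  field_simp
  rw [← Complex.exp_add, add_neg_cancel, Complex.exp_zero]

end PartitionIntegral

section EtaBounds
open ModularForm UpperHalfPlane MatrixGroups

lemma norm_tprod_one_sub_pow_sub_one_le {q : ℂ} (hq : ‖q‖ ≤ 1 / 210) :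
    ‖∏' k : ℕ, (1 - q ^ (k + 1)) - 1‖ ≤ 1.02 * ‖q‖ := by
  have hq1 : ‖q‖ < 1 := by linarith
  have h0 := norm_nonneg q
  have hs : HasSum (fun k : ℕ ↦ ‖-q ^ (k + 1)‖) (‖q‖ * (1 - ‖q‖)⁻¹) := by
    simpa [pow_succ'] using (hasSum_geometric_of_lt_one h0 hq1).mul_left ‖q‖
  have hm : Multipliable fun k : ℕ ↦ 1 + -q ^ (k + 1) :=
    multipliable_one_add_of_summable hs.summable
  have hlim := (hm.hasProd.tendsto_prod_nat.sub_const 1).norm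
  simp_rw [sub_eq_add_neg 1 (q ^ _)]
  have h1 : ‖q‖ * (1 - ‖q‖)⁻¹ ≤ ‖q‖ * (210 / 209) := by
    gcongr
    rw [inv_le_comm₀ (by linarith) (by norm_num)]
    norm_num
    linarith
  have h2 : rexp (‖q‖ * (210 / 209)) - 1 ≤ 1.02 * ‖q‖ := by
    have h3 := Real.abs_exp_sub_one_sub_id_le (x := ‖q‖ * (210 / 209))
      (by rw [abs_of_nonneg (by positivity)]; linarith)
    have h4 := (abs_le.mp h3).2
    nlinarith
  refine le_of_tendsto hlim (Eventually.of_forall fun N ↦ ?_)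
  refine (Finset.norm_prod_one_add_sub_one_le _ _).trans (le_trans ?_ h2)
  gcongr
  exact (hs.summable.sum_le_tsum _ fun _ _ ↦ norm_nonneg _).trans (hs.tsum_eq.le.trans h1)

lemma inv_norm_tprod_one_sub_pow_le {q : ℂ} (hq : ‖q‖ ≤ 1 / 210) :
    ‖∏' k : ℕ, (1 - q ^ (k + 1))‖⁻¹ ≤ 1.005 := by
  have h1 := norm_tprod_one_sub_pow_sub_one_le hq
  have h2 := norm_sub_norm_le (1 : ℂ) (1 - ∏' k : ℕ, (1 - q ^ (k + 1)))
  rw [norm_one, norm_sub_rev 1 (∏' k : ℕ, (1 - q ^ (k + 1))), sub_sub_cancel] at h2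
  have h3 : 0.9951 ≤ ‖∏' k : ℕ, (1 - q ^ (k + 1))‖ := by linarith
  rw [inv_le_comm₀ (by linarith) (by norm_num)]
  norm_num at h3 ⊢
  linarith

lemma norm_cexp_two_pi_I_mul (τ : ℂ) :
    ‖Complex.exp (2 * π * Complex.I * τ)‖ = rexp (-(2 * π * τ.im)) := by
  rw [Complex.norm_exp]
  simp

lemma exp_neg_le_one_div_210 {s : ℝ} (hs : 5.4 ≤ s) : rexp (-s) ≤ 1 / 210 := by
  rw [exp_neg, one_div]
  gcongr
  have h1 := quadratic_le_exp_of_nonneg (x := 0.4) (by norm_num)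
  have h2 : rexp 5.4 = rexp 1 ^ 5 * rexp 0.4 := by
    rw [← Real.exp_nat_mul, ← Real.exp_add]
    norm_num
  have h3 : (2.718 : ℝ) ^ 5 ≤ rexp 1 ^ 5 := by
    gcongr
    linarith [exp_one_gt_d9]
  calc (210 : ℝ) ≤ 2.718 ^ 5 * (1 + 0.4 + 0.4 ^ 2 / 2) := by norm_num
    _ ≤ rexp 5.4 := by rw [h2]; gcongr
    _ ≤ rexp s := by gcongr

lemma norm_cexp_two_pi_I_mul_le {τ : ℂ} (hτ : 0.86 ≤ τ.im) :
    ‖Complex.exp (2 * π * Complex.I * τ)‖ ≤ 1 / 210 := by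
  rw [norm_cexp_two_pi_I_mul]
  exact exp_neg_le_one_div_210 (by nlinarith [pi_gt_d2])

lemma inv_norm_eta_le {τ : ℂ} (hτ : 0.86 ≤ τ.im) : ‖η τ‖⁻¹ ≤ 1.005 * rexp (π * τ.im / 12) := by
  have h1 := inv_norm_tprod_one_sub_pow_le (norm_cexp_two_pi_I_mul_le hτ)
  have h2 : ‖Function.Periodic.qParam 24 τ‖⁻¹ = rexp (π * τ.im / 12) := by
    rw [Function.Periodic.norm_qParam, ← Real.exp_neg]
    congr 1
    ring
  rw [eta, norm_mul, mul_inv, h2, mul_comm]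
  simp_rw [eta_q_eq_pow]
  gcongr

lemma norm_eta_smul (γ : SL(2, ℤ)) (τ : ℍ) :
    ‖η τ‖ * τ.im ^ (1 / 4 : ℝ) = ‖η ↑(γ • τ)‖ * (γ • τ).im ^ (1 / 4 : ℝ) := by
  have h1 := SlashInvariantFormClass.norm_petersson_smul (k := 12)
    (f := CuspForm.discriminant) (f' := CuspForm.discriminant) (τ := τ)
    (g := Matrix.SpecialLinearGroup.mapGL ℝ γ) ⟨γ, rfl⟩
  have h3 : ∀ x : ℝ, 0 ≤ x → (x ^ (1 / 4 : ℝ)) ^ 48 = x ^ 12 := by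
    intro x hx
    rw [← Real.rpow_natCast, ← Real.rpow_mul hx, ← Real.rpow_natCast]
    norm_num
  have h2 : ∀ z : ℍ, ‖petersson 12 CuspForm.discriminant CuspForm.discriminant z‖ =
      (‖η z‖ * z.im ^ (1 / 4 : ℝ)) ^ 48 := by
    intro z
    rw [mul_pow, h3 _ z.im_pos.le, petersson, CuspForm.coe_discriminant, discriminant]
    simp only [norm_mul, RCLike.norm_conj, norm_pow, norm_zpow, Complex.norm_real,
      norm_of_nonneg z.im_pos.le]
    norm_cast
    ring
  rw [h2, h2] at h1
  exact ((pow_left_inj₀ (mul_nonneg (norm_nonneg _) (rpow_nonneg (γ • τ).im_pos.le _))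
    (mul_nonneg (norm_nonneg _) (rpow_nonneg τ.im_pos.le _)) (by norm_num)).mp h1).symm

/-- The size of `1 / η` is governed by the `SL₂(ℤ)`-translate lying in the fundamental domain. -/
lemma exists_inv_norm_eta_le {x y : ℝ} (hy : 0 < y) :
    ∃ c d : ℤ, IsCoprime c d ∧ 0 < (c * x + d) ^ 2 + (c * y) ^ 2 ∧
      0.866 * ((c * x + d) ^ 2 + (c * y) ^ 2) ≤ y ∧
      ‖η (x + y * Complex.I)‖⁻¹ ≤ 1.005 * (((c * x + d) ^ 2 + (c * y) ^ 2) ^ (1 / 4 : ℝ) *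
        rexp (π / 12 * (y / ((c * x + d) ^ 2 + (c * y) ^ 2)))) := by
  set τ : ℍ := ⟨x + y * Complex.I, by simpa using hy⟩ with hτ
  have hre : τ.re = x := by
    change (x + y * Complex.I : ℂ).re = x
    simp
  have him : τ.im = y := by
    change (x + y * Complex.I : ℂ).im = y
    simp
  obtain ⟨γ, hγ⟩ := ModularGroup.exists_smul_mem_fd τ
  have h1 := ModularGroup.three_le_four_mul_im_sq_of_mem_fd hγ
  have h2 : 0.866 ≤ (γ • τ).im := by
    nlinarith [(γ • τ).im_pos]
  have h3 := ModularGroup.im_smul_eq_div_normSq γ τ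
  have h4 : Complex.normSq (denom γ τ) = (γ 1 0 * x + γ 1 1) ^ 2 + (γ 1 0 * y) ^ 2 := by
    rw [ModularGroup.denom_apply, Complex.normSq_apply]
    simp [hre, him]
    ring
  have hD : 0 < Complex.normSq (denom γ τ) := normSq_denom_pos _ τ.im_ne_zero
  rw [him] at h3
  refine ⟨γ 1 0, γ 1 1, ModularGroup.bottom_row_coprime γ, ?_⟩
  rw [← h4]
  set D := Complex.normSq (denom γ τ)
  refine ⟨hD, ?_, ?_⟩
  · rw [h3, le_div_iff₀ hD] at h2
    exact h2
  have h5 := norm_eta_smul γ τ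
  have h6 := inv_norm_eta_le (τ := ↑(γ • τ)) (by rw [coe_im]; linarith)
  rw [coe_im, h3] at h6
  rw [him, h3, div_rpow hy.le hD.le] at h5
  have hy4 : 0 < y ^ (1 / 4 : ℝ) := rpow_pos_of_pos hy _
  have hD4 : 0 < D ^ (1 / 4 : ℝ) := rpow_pos_of_pos hD _
  have h7 : ‖η τ‖ = ‖η ↑(γ • τ)‖ / D ^ (1 / 4 : ℝ) := by
    field_simp at h5 ⊢
    linarith
  change ‖η τ‖⁻¹ ≤ _
  rw [h7, inv_div, div_eq_mul_inv]
  calc _ ≤ D ^ (1 / 4 : ℝ) * (1.005 * rexp (π * (y / D) / 12)) := by gcongr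
    _ = _ := by ring_nf

/-- Bound for `1 / η` away from the cusp at the integers. -/
lemma inv_norm_eta_le_of_minor {x y X : ℝ} (hy : 0 < y) (hX : 0 < X) (hXy : X ^ 2 + y ^ 2 = y)
    (h1 : X ≤ x) (h2 : x ≤ 1 - X) (hy' : y ≤ 1 / 36) :
    ‖η (x + y * Complex.I)‖⁻¹ ≤ 1.042 * y ^ (1 / 4 : ℝ) * rexp (π / (108 * y)) ∨
    (x - 1 / 2) ^ 2 ≤ 5 / 4 * y ^ 2 ∧
      ‖η (x + y * Complex.I)‖⁻¹ ≤ 1.005 * ((4 * ((x - 1 / 2) ^ 2 + y ^ 2)) ^ (1 / 4 : ℝ) *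
        rexp (π / 12 * (y / (4 * ((x - 1 / 2) ^ 2 + y ^ 2))))) := by
  obtain ⟨c, d, hcd, hD, hDy, h⟩ := exists_inv_norm_eta_le (x := x) hy
  set D := (c * x + d) ^ 2 + (c * y) ^ 2 with hDdef
  have key : y / D ≤ 1 / (9 * y) → ‖η (x + y * Complex.I)‖⁻¹ ≤
      1.042 * y ^ (1 / 4 : ℝ) * rexp (π / (108 * y)) := by
    intro hY
    refine h.trans ?_
    have e1 : D ^ (1 / 4 : ℝ) ≤ (1.0367 * y ^ (1 / 4 : ℝ)) := by
      have : D ≤ 1.0367 ^ 4 * y := by norm_num; linarith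
      calc D ^ (1 / 4 : ℝ) ≤ (1.0367 ^ 4 * y) ^ (1 / 4 : ℝ) := by gcongr
        _ = _ := by
          rw [mul_rpow (by positivity) hy.le, ← rpow_natCast, ← rpow_mul (by norm_num)]
          norm_num
    have e2 : π / 12 * (y / D) ≤ π / (108 * y) := by
      calc π / 12 * (y / D) ≤ π / 12 * (1 / (9 * y)) := by gcongr
        _ = _ := by field_simp; norm_num
    calc _ ≤ 1.005 * (1.0367 * y ^ (1 / 4 : ℝ) * rexp (π / (108 * y))) := by gcongr
      _ ≤ _ := by
        rw [← mul_assoc, ← mul_assoc]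
        gcongr
        norm_num
  by_cases hDe : D = 4 * ((x - 1 / 2) ^ 2 + y ^ 2)
  · by_cases hv : (x - 1 / 2) ^ 2 ≤ 5 / 4 * y ^ 2
    · exact Or.inr ⟨hv, hDe ▸ h⟩
    · refine Or.inl (key ?_)
      rw [div_le_div_iff₀ hD (by positivity), hDe]
      nlinarith
  have hX1 : X ≤ 1 / 2 := by linarith
  rcases le_or_gt 3 |c| with hc | hc
  · refine Or.inl (key ?_)
    have hc' : (9 : ℝ) ≤ (c : ℝ) ^ 2 := by
      rw [← sq_abs]
      have : (3 : ℝ) ≤ |(c : ℝ)| := by exact_mod_cast hc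
      nlinarith
    rw [div_le_div_iff₀ hD (by positivity)]
    nlinarith [sq_nonneg (c * x + d), sq_pos_of_pos hy]
  have key1 : y ≤ D → ‖η (x + y * Complex.I)‖⁻¹ ≤
      1.042 * y ^ (1 / 4 : ℝ) * rexp (π / (108 * y)) := by
    intro hY
    refine key (((div_le_one hD).mpr hY).trans ?_)
    rw [le_div_iff₀ (by positivity)]
    linarith
  have hcs : c = 0 ∨ c = 1 ∨ c = -1 ∨ c = 2 ∨ c = -2 := by
    rw [abs_lt] at hc
    omega
  rcases hcs with rfl | rfl | rfl | rfl | rfl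
  · exfalso
    have hd : (1 : ℝ) ≤ (d : ℝ) ^ 2 := by
      have : IsUnit d := isCoprime_zero_left.mp (by exact_mod_cast hcd)
      rcases Int.isUnit_iff.mp this with rfl | rfl <;> norm_num
    simp at hDdef
    nlinarith
  · refine Or.inl (key1 ?_)
    have : d ≤ -1 ∨ 0 ≤ d := by omega
    rcases this with hd | hd
    · have hd' : (d : ℝ) ≤ -1 := by exact_mod_cast hd
      rw [hDdef]; push_cast
      nlinarith
    · have hd' : (0 : ℝ) ≤ d := by exact_mod_cast hd
      rw [hDdef]; push_cast
      nlinarith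
  · refine Or.inl (key1 ?_)
    have : d ≤ 0 ∨ 1 ≤ d := by omega
    rcases this with hd | hd
    · have hd' : (d : ℝ) ≤ 0 := by exact_mod_cast hd
      rw [hDdef]; push_cast
      nlinarith
    · have hd' : (1 : ℝ) ≤ d := by exact_mod_cast hd
      rw [hDdef]; push_cast
      nlinarith
  · have hd0 : d ≠ 0 := by
      rintro rfl
      rw [isCoprime_zero_right, Int.isUnit_iff] at hcd
      omega
    have hd2 : d ≠ -2 := by
      rintro rfl
      have := hcd.isUnit_of_dvd' (x := 2) (by norm_num) (by norm_num)
      rw [Int.isUnit_iff] at this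
      omega
    by_cases hd1 : d = -1
    · refine absurd ?_ hDe
      rw [hDdef, hd1]
      push_cast
      ring
    exfalso
    rw [hDdef] at hDy
    push_cast at hDy
    have : d ≤ -3 ∨ 1 ≤ d := by omega
    rcases this with hd | hd
    · have hd' : (d : ℝ) ≤ -3 := by exact_mod_cast hd
      nlinarith
    · have hd' : (1 : ℝ) ≤ d := by exact_mod_cast hd
      nlinarith
  · have hd0 : d ≠ 0 := by
      rintro rfl
      rw [isCoprime_zero_right, Int.isUnit_iff] at hcd
      omega
    have hd2 : d ≠ 2 := by
      rintro rfl
      have := hcd.isUnit_of_dvd' (x := 2) (by norm_num) (by norm_num)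
      rw [Int.isUnit_iff] at this
      omega
    by_cases hd1 : d = 1
    · refine absurd ?_ hDe
      rw [hDdef, hd1]
      push_cast
      ring
    exfalso
    rw [hDdef] at hDy
    push_cast at hDy
    have : d ≤ -1 ∨ 3 ≤ d := by omega
    rcases this with hd | hd
    · have hd' : (d : ℝ) ≤ -1 := by exact_mod_cast hd
      nlinarith
    · have hd' : (3 : ℝ) ≤ d := by exact_mod_cast hd
      nlinarith

end EtaBounds

section BesselIntegral
open MeasureTheory

/-- The integrand of the Hankel-type contour integral producing the main term of `p n`. -/
noncomputable def besselIntegrand (μ ρ : ℝ) (w : ℂ) : ℂ :=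
  w ^ (2⁻¹ : ℂ) * Complex.exp (μ / 2 * (ρ / w + w / ρ))

lemma differentiableAt_besselIntegrand (μ ρ : ℝ) {w : ℂ} (hw : 0 < w.re) :
    DifferentiableAt ℂ (besselIntegrand μ ρ) w := by
  have h0 : w ≠ 0 := by
    rintro rfl
    simp at hw
  have h1 : w ∈ Complex.slitPlane := Or.inl hw
  unfold besselIntegrand
  refine DifferentiableAt.mul (differentiableAt_id.cpow_const h1) ?_
  refine DifferentiableAt.cexp ?_
  refine DifferentiableAt.const_mul (DifferentiableAt.add ?_ (by fun_prop)) _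
  exact (differentiableAt_const _).div differentiableAt_id h0

lemma exists_primitive_besselIntegrand (μ : ℝ) {ρ δ : ℝ} (hδ : 0 < δ) :
    ∃ G : ℂ → ℂ, ∀ w : ℂ, δ ≤ w.re → ‖w‖ ≤ 1 → HasDerivAt G (besselIntegrand μ ρ w) w := by
  have hd : DifferentiableOn ℂ (besselIntegrand μ ρ) (Metric.ball ((1 / δ : ℝ) : ℂ) (1 / δ)) := by
    intro w hw
    refine (differentiableAt_besselIntegrand μ ρ ?_).differentiableWithinAt
    rw [Metric.mem_ball, dist_eq_norm, norm_sub_rev] at hw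
    have := (Complex.re_le_norm _).trans_lt hw
    rw [Complex.sub_re, Complex.ofReal_re] at this
    linarith
  obtain ⟨G, hG⟩ := hd.isExactOn_ball
  refine ⟨G, fun w hw hw1 ↦ hG w ?_⟩
  have hδ' : 0 < 1 / δ := by positivity
  rw [Metric.mem_ball, dist_eq_norm]
  refine abs_lt_of_sq_lt_sq' ?_ hδ'.le |>.2
  rw [Complex.sq_norm, Complex.normSq_apply, Complex.sub_re, Complex.sub_im, Complex.ofReal_re,
    Complex.ofReal_im]
  have h2 : w.re * w.re + w.im * w.im ≤ 1 := by
    rw [← Complex.normSq_apply, ← Complex.sq_norm]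
    nlinarith [norm_nonneg w]
  have h3 : 1 ≤ w.re * (1 / δ) := by
    rw [mul_one_div, le_div_iff₀ hδ]
    linarith
  nlinarith

lemma integral_arc_besselIntegrand {μ ρ s₀ : ℝ} (hρ : 0 < ρ) (hρ1 : ρ ≤ 1) (h0 : 0 ≤ s₀)
    (hs₀ : 2 * s₀ ^ 2 < 1) {G : ℂ → ℂ}
    (hG : ∀ w : ℂ, ρ * (1 - 2 * s₀ ^ 2) ≤ w.re → ‖w‖ ≤ 1 →
      HasDerivAt G (besselIntegrand μ ρ w) w) :
    G (ρ * (√(1 - s₀ ^ 2) + s₀ * Complex.I) ^ 2) - G (ρ * (√(1 - s₀ ^ 2) - s₀ * Complex.I) ^ 2) =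
      2 * Complex.I * (ρ * √ρ *
        ∫ s in (-s₀)..s₀, (1 - 4 * s ^ 2) * rexp (μ * (1 - 2 * s ^ 2)) : ℝ) := by
  set ζ : ℝ → ℂ := fun s ↦ √(1 - s ^ 2) + s * Complex.I with hζ
  have hs : ∀ s ∈ Set.uIcc (-s₀) s₀, s ^ 2 ≤ s₀ ^ 2 := by
    intro s hs
    rw [Set.uIcc_of_le (by linarith)] at hs
    exact sq_le_sq' hs.1 hs.2
  have hsq : ∀ s ∈ Set.uIcc (-s₀) s₀, √(1 - s ^ 2) ^ 2 = 1 - s ^ 2 := fun s h ↦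
    Real.sq_sqrt (by have := hs s h; nlinarith)
  have hpos : ∀ s ∈ Set.uIcc (-s₀) s₀, 0 < √(1 - s ^ 2) := fun s h ↦
    Real.sqrt_pos.mpr (by have := hs s h; nlinarith)
  have hre : ∀ s, (ζ s).re = √(1 - s ^ 2) := fun s ↦ by simp [hζ]
  have him : ∀ s, (ζ s).im = s := fun s ↦ by simp [hζ]
  have hinv : ∀ s ∈ Set.uIcc (-s₀) s₀, ζ s * (√(1 - s ^ 2) - s * Complex.I) = 1 := by
    intro s h
    have h2 : (√(1 - s ^ 2) : ℂ) ^ 2 = 1 - s ^ 2 := by exact_mod_cast hsq s h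
    simp only [hζ]
    linear_combination h2 - (s : ℂ) ^ 2 * Complex.I_sq
  have hg : ∀ s ∈ Set.uIcc (-s₀) s₀, besselIntegrand μ ρ (ρ * ζ s ^ 2) =
      √ρ * ζ s * rexp (μ * (1 - 2 * s ^ 2)) := by
    intro s h
    have hζ0 : ζ s ≠ 0 := left_ne_zero_of_mul_eq_one (hinv s h)
    have hρ0 : (ρ : ℂ) ≠ 0 := by exact_mod_cast hρ.ne'
    have h1 : (ρ : ℂ) * ζ s ^ 2 = (√ρ * ζ s) ^ 2 := by
      rw [mul_pow]
      congr 1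
      exact_mod_cast (Real.sq_sqrt hρ.le).symm
    have h2 : 0 < ((√ρ : ℂ) * ζ s).re := by
      rw [Complex.re_ofReal_mul, hre]
      exact mul_pos (Real.sqrt_pos.mpr hρ) (hpos s h)
    rw [besselIntegrand]
    nth_rewrite 1 [h1]
    rw [Complex.sq_cpow_two_inv h2, Complex.ofReal_exp]
    congr 2
    have h3 : (ρ : ℂ) / (ρ * ζ s ^ 2) = (√(1 - s ^ 2) - s * Complex.I) ^ 2 := by
      rw [div_eq_iff (by positivity)]
      linear_combination (-(ρ : ℂ)) * (ζ s * (√(1 - s ^ 2) - s * Complex.I) + 1) * hinv s h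
    have h4 : (√(1 - s ^ 2) : ℂ) ^ 2 = 1 - s ^ 2 := by exact_mod_cast hsq s h
    rw [h3, mul_div_cancel_left₀ (ζ s ^ 2) hρ0]
    simp only [hζ]
    push_cast
    linear_combination (μ : ℂ) * h4 + (μ : ℂ) * s ^ 2 * Complex.I_sq
  have hmem : ∀ s ∈ Set.uIcc (-s₀) s₀, HasDerivAt G (besselIntegrand μ ρ (ρ * ζ s ^ 2))
      (ρ * ζ s ^ 2) := by
    intro s h
    refine hG _ ?_ ?_
    · rw [Complex.re_ofReal_mul, pow_two (ζ s), Complex.mul_re, hre, him]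
      have := hs s h
      have := hsq s h
      refine mul_le_mul_of_nonneg_left ?_ hρ.le
      nlinarith
    · have : ‖ζ s‖ ^ 2 = 1 := by
        rw [Complex.sq_norm, Complex.normSq_apply, hre, him]
        have := hsq s h
        rw [← pow_two, ← pow_two, this]
        ring
      rw [norm_mul, norm_pow, this, mul_one, Complex.norm_real, norm_of_nonneg hρ.le]
      exact hρ1
  have hderiv : ∀ s ∈ Set.uIcc (-s₀) s₀, HasDerivAt (fun s : ℝ ↦ G (ρ * ζ s ^ 2))
      (2 * Complex.I * (ρ * √ρ) * ((1 - 4 * s ^ 2) * rexp (μ * (1 - 2 * s ^ 2)) : ℝ) +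
        2 * Complex.I * (ρ * √ρ) * Complex.I *
          ((3 * s * √(1 - s ^ 2) - s ^ 3 / √(1 - s ^ 2)) * rexp (μ * (1 - 2 * s ^ 2)) : ℝ)) s := by
    intro s h
    have hp := hpos s h
    have hp' : (√(1 - s ^ 2) : ℂ) ≠ 0 := by exact_mod_cast hp.ne'
    have d1 : HasDerivAt (fun s : ℝ ↦ √(1 - s ^ 2)) (-(2 * s) / (2 * √(1 - s ^ 2))) s := by
      refine HasDerivAt.sqrt ?_ (by rw [← hsq s h]; positivity)
      simpa using ((hasDerivAt_id s).pow 2).const_sub 1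
    have d2 : HasDerivAt ζ ((-(2 * s) / (2 * √(1 - s ^ 2)) : ℝ) + 1 * Complex.I) s :=
      d1.ofReal_comp.add ((hasDerivAt_id s).ofReal_comp.mul_const _)
    have d3 := (hmem s h).comp s ((d2.pow 2).const_mul (ρ : ℂ))
    refine d3.congr_deriv ?_
    rw [hg s h]
    have h4 : (√(1 - s ^ 2) : ℂ) ^ 2 = 1 - s ^ 2 := by exact_mod_cast hsq s h
    simp only [hζ]
    push_cast
    obtain ⟨u, hu⟩ : ∃ u : ℂ, (√(1 - s ^ 2) : ℂ)⁻¹ = u := ⟨_, rfl⟩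
    have hu' : (√(1 - s ^ 2) : ℂ) * u = 1 := by rw [← hu, mul_inv_cancel₀ hp']
    have e1 : -(2 * (s : ℂ)) / (2 * (√(1 - s ^ 2) : ℂ)) = -(s * u) := by
      rw [← hu]; field_simp
    rw [e1, div_eq_mul_inv, hu]
    generalize (√(1 - s ^ 2) : ℂ) = t at *
    linear_combination 2 * (ρ : ℂ) * √ρ * Complex.exp (μ * (1 - 2 * s ^ 2)) *
      ((-s * t - 2 * s ^ 2 * Complex.I) * hu' +
        (-(s : ℂ) ^ 3 * u + 2 * t * s + s ^ 2 * Complex.I - (3 * s * t - s ^ 3 * u)) *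
          Complex.I_sq +
        Complex.I * h4)
  have hc1 : ContinuousOn (fun s : ℝ ↦ (1 - 4 * s ^ 2) * rexp (μ * (1 - 2 * s ^ 2)))
      (Set.uIcc (-s₀) s₀) := by fun_prop
  have hc2 : ContinuousOn (fun s : ℝ ↦ (3 * s * √(1 - s ^ 2) - s ^ 3 / √(1 - s ^ 2)) *
      rexp (μ * (1 - 2 * s ^ 2))) (Set.uIcc (-s₀) s₀) := by
    refine ContinuousOn.mul (ContinuousOn.sub (by fun_prop) (ContinuousOn.div (by fun_prop)
      (by fun_prop) fun s h ↦ (hpos s h).ne')) (by fun_prop)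
  have hodd : ∫ s in (-s₀)..s₀, (3 * s * √(1 - s ^ 2) - s ^ 3 / √(1 - s ^ 2)) *
      rexp (μ * (1 - 2 * s ^ 2)) = 0 := by
    have := intervalIntegral.integral_comp_neg (a := -s₀) (b := s₀)
      fun s : ℝ ↦ (3 * s * √(1 - s ^ 2) - s ^ 3 / √(1 - s ^ 2)) * rexp (μ * (1 - 2 * s ^ 2))
    rw [neg_neg] at this
    have h2 : ∀ s : ℝ, (3 * -s * √(1 - (-s) ^ 2) - (-s) ^ 3 / √(1 - (-s) ^ 2)) *
        rexp (μ * (1 - 2 * (-s) ^ 2)) = -((3 * s * √(1 - s ^ 2) - s ^ 3 / √(1 - s ^ 2)) *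
        rexp (μ * (1 - 2 * s ^ 2))) := by
      intro s
      rw [neg_sq]
      ring
    simp_rw [h2] at this
    rw [intervalIntegral.integral_neg] at this
    linarith
  have hi1 : IntervalIntegrable (fun s : ℝ ↦ 2 * Complex.I * (ρ * √ρ) *
      ((1 - 4 * s ^ 2) * rexp (μ * (1 - 2 * s ^ 2)) : ℝ)) volume (-s₀) s₀ :=
    (continuousOn_const.mul (Complex.continuous_ofReal.comp_continuousOn hc1)).intervalIntegrable
  have hi2 : IntervalIntegrable (fun s : ℝ ↦ 2 * Complex.I * (ρ * √ρ) * Complex.I *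
      ((3 * s * √(1 - s ^ 2) - s ^ 3 / √(1 - s ^ 2)) * rexp (μ * (1 - 2 * s ^ 2)) : ℝ))
      volume (-s₀) s₀ :=
    (continuousOn_const.mul (Complex.continuous_ofReal.comp_continuousOn hc2)).intervalIntegrable
  have hftc := intervalIntegral.integral_eq_sub_of_hasDerivAt hderiv (hi1.add hi2)
  rw [intervalIntegral.integral_add hi1 hi2, intervalIntegral.integral_const_mul,
    intervalIntegral.integral_const_mul, intervalIntegral.integral_ofReal,
    intervalIntegral.integral_ofReal, hodd] at hftc
  have e1 : ζ s₀ = √(1 - s₀ ^ 2) + s₀ * Complex.I := rfl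
  have e2 : ζ (-s₀) = √(1 - s₀ ^ 2) - s₀ * Complex.I := by
    simp only [hζ, neg_sq]
    push_cast
    ring
  rw [← e1, ← e2, ← hftc]
  push_cast
  ring

lemma integral_gaussian_sub_intervalIntegral {b s₀ : ℝ} (hb : 1 ≤ b) (h0 : 0 ≤ s₀) :
    |(∫ s in (-s₀)..s₀, rexp (-b * s ^ 2)) - √(π / b)| ≤
      rexp (-(b - 1) * s₀ ^ 2) * √π := by
  have hi : ∀ a : ℝ, 0 < a → Integrable fun s : ℝ ↦ rexp (-a * s ^ 2) := fun a ha ↦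
    integrable_exp_neg_mul_sq ha
  have h1 := integral_add_compl (s := Set.Ioc (-s₀) s₀) measurableSet_Ioc (hi b (by linarith))
  rw [integral_gaussian, ← intervalIntegral.integral_of_le (by linarith)] at h1
  rw [abs_sub_comm, ← h1, add_sub_cancel_left,
    abs_of_nonneg (integral_nonneg fun _ ↦ (exp_pos _).le)]
  calc ∫ s in (Set.Ioc (-s₀) s₀)ᶜ, rexp (-b * s ^ 2)
      ≤ ∫ s in (Set.Ioc (-s₀) s₀)ᶜ, rexp (-(b - 1) * s₀ ^ 2) * rexp (-1 * s ^ 2) := by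
        refine setIntegral_mono_on (hi b (by linarith)).integrableOn
          ((hi 1 one_pos).const_mul _).integrableOn measurableSet_Ioc.compl fun s hs ↦ ?_
        rw [← Real.exp_add]
        gcongr
        have : s₀ ^ 2 ≤ s ^ 2 := by
          rw [Set.mem_compl_iff, Set.mem_Ioc, not_and_or, not_lt, not_le] at hs
          rcases hs with hs | hs <;> nlinarith
        nlinarith
    _ ≤ ∫ s, rexp (-(b - 1) * s₀ ^ 2) * rexp (-1 * s ^ 2) :=
        setIntegral_le_integral ((hi 1 one_pos).const_mul _)
          (Eventually.of_forall fun _ ↦ by positivity)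
    _ = _ := by rw [integral_const_mul, integral_gaussian, div_one]

lemma integral_arc_approx {μ : ℝ} (hμ : 75 ≤ μ) :
    |(∫ s in (-(2 / 3 : ℝ))..2 / 3, (1 - 4 * s ^ 2) * rexp (μ * (1 - 2 * s ^ 2))) -
      (1 - 1 / μ) * √(π / (2 * μ)) * rexp μ| ≤ 5 * rexp (μ / 9) := by
  have hμ0 : μ ≠ 0 := by positivity
  have hd : ∀ s : ℝ, HasDerivAt (fun s : ℝ ↦ 1 / μ * (s * rexp (μ * (1 - 2 * s ^ 2))))
      ((1 - 4 * s ^ 2) * rexp (μ * (1 - 2 * s ^ 2)) -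
        (1 - 1 / μ) * rexp μ * rexp (-(2 * μ) * s ^ 2)) s := by
    intro s
    have h1 : HasDerivAt (fun s : ℝ ↦ μ * (1 - 2 * s ^ 2)) (μ * (-(2 * (2 * s)))) s := by
      simpa using ((((hasDerivAt_id s).pow 2).const_mul 2).const_sub 1).const_mul μ
    refine (((hasDerivAt_id s).mul h1.exp).const_mul (1 / μ)).congr_deriv ?_
    have e : rexp (μ * (1 - 2 * s ^ 2)) = rexp μ * rexp (-(2 * μ) * s ^ 2) := by
      rw [← Real.exp_add]
      ring_nf
    simp only [id]
    rw [mul_assoc (1 - 1 / μ), ← e]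
    field_simp
    ring
  have h1 := intervalIntegral.integral_eq_sub_of_hasDerivAt (a := -(2 / 3)) (b := 2 / 3)
    (fun s _ ↦ hd s) (by apply Continuous.intervalIntegrable; fun_prop)
  rw [intervalIntegral.integral_sub (by apply Continuous.intervalIntegrable; fun_prop)
    (by apply Continuous.intervalIntegrable; fun_prop), intervalIntegral.integral_const_mul] at h1
  have h2 := integral_gaussian_sub_intervalIntegral (b := 2 * μ) (s₀ := 2 / 3) (by linarith)
    (by norm_num)
  set A := ∫ s in (-(2 / 3 : ℝ))..2 / 3, (1 - 4 * s ^ 2) * rexp (μ * (1 - 2 * s ^ 2))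
  set B := ∫ s in (-(2 / 3 : ℝ))..2 / 3, rexp (-(2 * μ) * s ^ 2)
  have e1 : μ * (1 - 2 * (2 / 3 : ℝ) ^ 2) = μ / 9 := by ring
  have e2 : μ * (1 - 2 * (-(2 / 3) : ℝ) ^ 2) = μ / 9 := by ring
  rw [e1, e2] at h1
  have e3 : A - (1 - 1 / μ) * √(π / (2 * μ)) * rexp μ =
      4 / 3 / μ * rexp (μ / 9) + (1 - 1 / μ) * (rexp μ * (B - √(π / (2 * μ)))) := by
    linear_combination h1
  have h3 : 0 ≤ 1 - 1 / μ := by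
    rw [sub_nonneg, div_le_one (by linarith)]
    linarith
  have h4 : 1 - 1 / μ ≤ 1 := by
    have : 0 ≤ 1 / μ := by positivity
    linarith
  have h5 : rexp μ * (rexp (-(2 * μ - 1) * (2 / 3) ^ 2) * √π) ≤ 3 * rexp (μ / 9) := by
    have : rexp μ * rexp (-(2 * μ - 1) * (2 / 3) ^ 2) = rexp (μ / 9) * rexp (4 / 9) := by
      rw [← Real.exp_add, ← Real.exp_add]
      ring_nf
    rw [← mul_assoc, this]
    have h6 : √π ≤ 1.8 := Real.sqrt_le_iff.mpr ⟨by norm_num, by linarith [pi_lt_d2]⟩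
    have h7 : rexp (4 / 9) ≤ 5 / 3 := by
      have h8 := Real.abs_exp_sub_one_sub_id_le (x := 4 / 9) (by norm_num [abs_le])
      have := (abs_le.mp h8).2
      norm_num at this ⊢
      linarith
    calc _ ≤ rexp (μ / 9) * (5 / 3) * 1.8 := by gcongr
      _ = _ := by ring
  have h9 : 4 / 3 / μ ≤ 1 := by
    rw [div_le_one (by linarith)]
    linarith
  rw [e3]
  refine (abs_add_le _ _).trans ?_
  rw [abs_mul, abs_mul, abs_mul, abs_of_nonneg h3, abs_of_pos (exp_pos _), abs_of_pos (exp_pos _),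
    abs_of_nonneg (show 0 ≤ 4 / 3 / μ by positivity)]
  calc _ ≤ 1 * rexp (μ / 9) + 1 * (rexp μ * (rexp (-(2 * μ - 1) * (2 / 3) ^ 2) * √π)) := by gcongr
    _ ≤ _ := by
      have := exp_pos (μ / 9)
      linarith

lemma re_besselIntegrand_exponent (μ ρ : ℝ) (w : ℂ) :
    ((μ : ℂ) / 2 * (ρ / w + w / ρ)).re =
      μ / 2 * (ρ * w.re / (w.re ^ 2 + w.im ^ 2) + w.re / ρ) := by
  have hn : Complex.normSq w = w.re ^ 2 + w.im ^ 2 := by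
    rw [Complex.normSq_apply]
    ring
  rw [show (μ : ℂ) / 2 = ((μ / 2 : ℝ) : ℂ) by push_cast; rfl, Complex.re_ofReal_mul,
    Complex.add_re, Complex.div_ofReal_re, div_eq_mul_inv (ρ : ℂ), Complex.re_ofReal_mul,
    Complex.inv_re, hn, mul_div_assoc]

lemma norm_besselIntegrand_le {μ ρ : ℝ} (hμ : 0 ≤ μ) {w : ℂ} (hw : 0 < w.re) (hw1 : ‖w‖ ≤ 1)
    (h : ρ * w.re / (w.re ^ 2 + w.im ^ 2) + w.re / ρ ≤ 0.54) :
    ‖besselIntegrand μ ρ w‖ ≤ rexp (0.27 * μ) := by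
  have h0 : w ≠ 0 := by
    rintro rfl
    simp at hw
  have h2 : ‖w ^ (2⁻¹ : ℂ)‖ ≤ 1 := by
    rw [show (2⁻¹ : ℂ) = ((2⁻¹ : ℝ) : ℂ) by push_cast; rfl,
      Complex.norm_cpow_of_ne_zero h0]
    simp only [Complex.ofReal_re, Complex.ofReal_im, mul_zero, Real.exp_zero, div_one]
    exact Real.rpow_le_one (norm_nonneg _) hw1 (by norm_num)
  rw [besselIntegrand, norm_mul, Complex.norm_exp, re_besselIntegrand_exponent]
  calc _ ≤ 1 * rexp (μ / 2 * 0.54) := by gcongr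
    _ = _ := by ring_nf

lemma norm_primitive_besselIntegrand_sub_le {μ ρ δ : ℝ} (hμ : 0 ≤ μ) (hδ : 0 < δ) {G : ℂ → ℂ}
    (hG : ∀ w : ℂ, δ ≤ w.re → ‖w‖ ≤ 1 → HasDerivAt G (besselIntegrand μ ρ w) w) {P Q : ℂ}
    (h : ∀ w ∈ segment ℝ P Q, δ ≤ w.re ∧ ‖w‖ ≤ 1 ∧
      ρ * w.re / (w.re ^ 2 + w.im ^ 2) + w.re / ρ ≤ 0.54) :
    ‖G Q - G P‖ ≤ 2 * rexp (0.27 * μ) := by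
  have h1 := Convex.norm_image_sub_le_of_norm_hasDerivWithin_le (C := rexp (0.27 * μ))
    (fun w hw ↦ (hG w (h w hw).1 (h w hw).2.1).hasDerivWithinAt)
    (fun w hw ↦ norm_besselIntegrand_le hμ (hδ.trans_le (h w hw).1) (h w hw).2.1 (h w hw).2.2)
    (convex_segment P Q) (left_mem_segment ℝ P Q) (right_mem_segment ℝ P Q)
  have h2 : ‖Q - P‖ ≤ 2 := by
    have hP := (h P (left_mem_segment ℝ P Q)).2.1
    have hQ := (h Q (right_mem_segment ℝ P Q)).2.1
    linarith [norm_sub_le Q P]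
  calc _ ≤ _ := h1
    _ ≤ rexp (0.27 * μ) * 2 := by gcongr
    _ = _ := mul_comm _ _

/-- Deformation of the two ends of the vertical contour to the circle `‖w‖ = ρ`; the sign `ε`
selects the end. -/
lemma norm_primitive_besselIntegrand_sub_arc_le {μ ρ θ ε : ℝ} (hμ : 0 ≤ μ) (hρ : 0 < ρ)
    (hρ1 : ρ ≤ 0.1) (hθ : 4 * ρ ≤ θ) (hθ1 : θ ≤ 0.9) (hε : ε ^ 2 = 1) {G : ℂ → ℂ}
    (hG : ∀ w : ℂ, ρ / 9 ≤ w.re → ‖w‖ ≤ 1 → HasDerivAt G (besselIntegrand μ ρ w) w) :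
    ‖G ⟨ρ / 2, ε * θ⟩ - G ⟨ρ / 9, ε * (4 * √5 / 9 * ρ)⟩‖ ≤ 4 * rexp (0.27 * μ) := by
  have h5 : √5 ^ 2 = 5 := Real.sq_sqrt (by norm_num)
  have h5' : 0 ≤ √5 := Real.sqrt_nonneg 5
  have h5'' : √5 ≤ 9 / 4 := Real.sqrt_le_iff.mpr ⟨by norm_num, by norm_num⟩
  have hnorm : ∀ a b : ℝ, a ^ 2 + b ^ 2 ≤ 1 → ‖(⟨a, b⟩ : ℂ)‖ ≤ 1 := by
    intro a b hab
    rw [← sq_le_one_iff₀ (norm_nonneg _), Complex.sq_norm, Complex.normSq_apply]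
    simpa [pow_two] using hab
  have s1 : ‖G ⟨ρ / 9, ε * θ⟩ - G ⟨ρ / 9, ε * (4 * √5 / 9 * ρ)⟩‖ ≤ 2 * rexp (0.27 * μ) := by
    refine norm_primitive_besselIntegrand_sub_le hμ (by positivity) hG fun w hw ↦ ?_
    rw [segment_eq_image'] at hw
    obtain ⟨t, ⟨ht0, ht1⟩, rfl⟩ := hw
    set b := 4 * √5 / 9 * ρ + t * (θ - 4 * √5 / 9 * ρ)
    have e : (⟨ρ / 9, ε * (4 * √5 / 9 * ρ)⟩ + t • (⟨ρ / 9, ε * θ⟩ - ⟨ρ / 9, ε * (4 * √5 / 9 * ρ)⟩)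
        : ℂ) = ⟨ρ / 9, ε * b⟩ := by
      apply Complex.ext
      · simp
      · simp only [Complex.add_im, Complex.real_smul, Complex.im_ofReal_mul, Complex.sub_im, b]
        ring
    have hb1 : 4 * √5 / 9 * ρ ≤ b := by
      have : 0 ≤ t * (θ - 4 * √5 / 9 * ρ) := mul_nonneg ht0 (by nlinarith)
      simp only [b]
      linarith
    have hb2 : b ≤ θ := by
      have : 0 ≤ (1 - t) * (θ - 4 * √5 / 9 * ρ) := mul_nonneg (by linarith) (by nlinarith)
      simp only [b]
      linarith
    have hb0 : 0 ≤ b := le_trans (by positivity) hb1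
    have hb3 : 80 / 81 * ρ ^ 2 ≤ b ^ 2 := by
      calc 80 / 81 * ρ ^ 2 = (4 * √5 / 9 * ρ) ^ 2 := by rw [mul_pow, div_pow, mul_pow, h5]; ring
        _ ≤ b ^ 2 := by gcongr
    beta_reduce
    rw [e]
    refine ⟨le_rfl, hnorm _ _ ?_, ?_⟩
    · rw [mul_pow, hε]
      nlinarith
    · simp only
      rw [mul_pow, hε, one_mul]
      have e1 : ρ * (ρ / 9) / ((ρ / 9) ^ 2 + b ^ 2) ≤ 1 / 9 := by
        rw [div_le_iff₀ (by positivity)]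
        nlinarith
      have e2 : ρ / 9 / ρ = 1 / 9 := by field_simp
      rw [e2]
      norm_num at e1 ⊢
      linarith
  have s2 : ‖G ⟨ρ / 2, ε * θ⟩ - G ⟨ρ / 9, ε * θ⟩‖ ≤ 2 * rexp (0.27 * μ) := by
    refine norm_primitive_besselIntegrand_sub_le hμ (show 0 < ρ / 9 by positivity) hG fun w hw ↦ ?_
    rw [segment_eq_image'] at hw
    obtain ⟨t, ⟨ht0, ht1⟩, rfl⟩ := hw
    set a := ρ / 9 + t * (ρ / 2 - ρ / 9)
    have e : (⟨ρ / 9, ε * θ⟩ + t • (⟨ρ / 2, ε * θ⟩ - ⟨ρ / 9, ε * θ⟩) : ℂ) = ⟨a, ε * θ⟩ := by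
      apply Complex.ext
      · simp only [Complex.add_re, Complex.real_smul, Complex.re_ofReal_mul, Complex.sub_re, a]
      · simp
    have ha1 : ρ / 9 ≤ a := by
      have : 0 ≤ t * (ρ / 2 - ρ / 9) := mul_nonneg ht0 (by linarith)
      simp only [a]
      linarith
    have ha2 : a ≤ ρ / 2 := by
      have : 0 ≤ (1 - t) * (ρ / 2 - ρ / 9) := mul_nonneg (by linarith) (by linarith)
      simp only [a]
      linarith
    have ha0 : 0 < a := by linarith
    beta_reduce
    rw [e]
    refine ⟨ha1, hnorm _ _ ?_, ?_⟩
    · rw [mul_pow, hε]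
      nlinarith
    · simp only
      rw [mul_pow, hε, one_mul]
      have e1 : ρ * a / (a ^ 2 + θ ^ 2) ≤ 1 / 32 := by
        rw [div_le_iff₀ (by positivity)]
        nlinarith
      have e2 : a / ρ ≤ 1 / 2 := by
        rw [div_le_iff₀ hρ]
        linarith
      norm_num at e1 e2 ⊢
      linarith
  calc _ = ‖(G ⟨ρ / 2, ε * θ⟩ - G ⟨ρ / 9, ε * θ⟩) +
        (G ⟨ρ / 9, ε * θ⟩ - G ⟨ρ / 9, ε * (4 * √5 / 9 * ρ)⟩)‖ := by rw [sub_add_sub_cancel]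
    _ ≤ _ := (norm_add_le _ _).trans (by linarith)

lemma integral_besselIntegrand_approx {μ ρ X : ℝ} (hμ : 75 ≤ μ) (hρ : 0 < ρ) (hρ1 : ρ ≤ 0.05)
    (hX : 0 < X) (hX1 : 2 * ρ ≤ π * X) (hX2 : 2 * π * X ≤ 0.9) :
    ‖(2 * π * Complex.I) * (∫ x in (-X)..X, besselIntegrand μ ρ (ρ / 2 - 2 * π * x * Complex.I)) -
      2 * Complex.I * (ρ * √ρ * ((1 - 1 / μ) * √(π / (2 * μ)) * rexp μ) : ℝ)‖ ≤
      9 * rexp (0.27 * μ) := by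
  obtain ⟨G, hG⟩ := exists_primitive_besselIntegrand μ (ρ := ρ) (δ := ρ / 9) (by positivity)
  have h1 : ∀ x ∈ Set.uIcc (-X) X, HasDerivAt (fun x : ℝ ↦ -G (ρ / 2 - 2 * π * x * Complex.I))
      ((2 * π * Complex.I) * besselIntegrand μ ρ (ρ / 2 - 2 * π * x * Complex.I)) x := by
    intro x hx
    rw [Set.uIcc_of_le (by linarith)] at hx
    have hre : ((ρ : ℂ) / 2 - 2 * π * x * Complex.I).re = ρ / 2 := by simp
    have him : ((ρ : ℂ) / 2 - 2 * π * x * Complex.I).im = -(2 * π * x) := by simp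
    have d1 : HasDerivAt (fun x : ℝ ↦ (ρ : ℂ) / 2 - 2 * π * x * Complex.I)
        (-(2 * π * 1 * Complex.I)) x :=
      (((hasDerivAt_id x).ofReal_comp.const_mul (2 * π : ℂ)).mul_const Complex.I).const_sub _
    have d2 := ((hG _ (by rw [hre]; linarith) ?_).comp x d1).neg
    · exact d2.congr_deriv (by ring)
    · rw [← sq_le_one_iff₀ (norm_nonneg _), Complex.sq_norm, Complex.normSq_apply, hre, him]
      have : x ^ 2 ≤ X ^ 2 := sq_le_sq' hx.1 hx.2
      have h3 : (2 * π * X) ^ 2 ≤ 0.9 ^ 2 := by gcongr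
      have h4 : (2 * π * x) ^ 2 ≤ (2 * π * X) ^ 2 := by
        rw [mul_pow, mul_pow _ X]
        gcongr
      nlinarith
  have hcont : ContinuousOn (fun x : ℝ ↦ (2 * π * Complex.I) *
      besselIntegrand μ ρ (ρ / 2 - 2 * π * x * Complex.I)) (Set.uIcc (-X) X) := by
    intro x hx
    refine (ContinuousAt.mul continuousAt_const ?_).continuousWithinAt
    refine ContinuousAt.comp (f := fun x : ℝ ↦ (ρ : ℂ) / 2 - 2 * π * x * Complex.I)
      (differentiableAt_besselIntegrand μ ρ (by simpa using hρ)).continuousAt (by fun_prop)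
  have h2 := intervalIntegral.integral_eq_sub_of_hasDerivAt h1 hcont.intervalIntegrable
  rw [intervalIntegral.integral_const_mul] at h2
  have h3 := integral_arc_besselIntegrand (μ := μ) (s₀ := 2 / 3) hρ (by linarith) (by norm_num)
    (by norm_num) (G := G) fun w hw ↦ hG w (by linarith)
  have h59 : √(1 - (2 / 3) ^ 2) = √5 / 3 := by
    rw [show (1 - (2 / 3 : ℝ) ^ 2) = 5 / 3 ^ 2 by norm_num, Real.sqrt_div (by norm_num),
      Real.sqrt_sq (by norm_num)]
  have h5 : √5 ^ 2 = 5 := Real.sq_sqrt (by norm_num)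
  have e1 : (ρ : ℂ) * (√(1 - (2 / 3) ^ 2) + (2 / 3 : ℝ) * Complex.I) ^ 2 =
      ⟨ρ / 9, 1 * (4 * √5 / 9 * ρ)⟩ := by
    rw [h59]
    apply Complex.ext
    · rw [Complex.re_ofReal_mul, pow_two, Complex.mul_re]
      simp
      linear_combination ρ / 9 * h5
    · rw [Complex.im_ofReal_mul, pow_two, Complex.mul_im]
      simp
      ring
  have e2 : (ρ : ℂ) * (√(1 - (2 / 3) ^ 2) - (2 / 3 : ℝ) * Complex.I) ^ 2 =
      ⟨ρ / 9, -1 * (4 * √5 / 9 * ρ)⟩ := by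
    rw [h59]
    apply Complex.ext
    · rw [Complex.re_ofReal_mul, pow_two, Complex.mul_re]
      simp
      linear_combination ρ / 9 * h5
    · rw [Complex.im_ofReal_mul, pow_two, Complex.mul_im]
      simp
      ring
  have e3 : (ρ : ℂ) / 2 - 2 * π * X * Complex.I = ⟨ρ / 2, -1 * (2 * π * X)⟩ := by
    apply Complex.ext <;> simp
  have e4 : (ρ : ℂ) / 2 - 2 * π * (-X : ℝ) * Complex.I = ⟨ρ / 2, 1 * (2 * π * X)⟩ := by
    apply Complex.ext <;> simp
  rw [e1, e2] at h3
  rw [e3, e4] at h2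
  have k1 := norm_primitive_besselIntegrand_sub_arc_le (ε := 1) (θ := 2 * π * X) (by linarith) hρ
    (by linarith) (by linarith) hX2 (by norm_num) hG
  have k2 := norm_primitive_besselIntegrand_sub_arc_le (ε := -1) (θ := 2 * π * X) (by linarith) hρ
    (by linarith) (by linarith) hX2 (by norm_num) hG
  have k3 := integral_arc_approx hμ
  set I₁ := ∫ s in (-(2 / 3 : ℝ))..2 / 3, (1 - 4 * s ^ 2) * rexp (μ * (1 - 2 * s ^ 2))
  set I₂ := (1 - 1 / μ) * √(π / (2 * μ)) * rexp μ
  set P₁ : ℂ := ⟨ρ / 2, 1 * (2 * π * X)⟩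
  set P₂ : ℂ := ⟨ρ / 2, -1 * (2 * π * X)⟩
  set Q₁ : ℂ := ⟨ρ / 9, 1 * (4 * √5 / 9 * ρ)⟩
  set Q₂ : ℂ := ⟨ρ / 9, -1 * (4 * √5 / 9 * ρ)⟩
  have e5 : -G P₂ - -G P₁ - 2 * Complex.I * (ρ * √ρ * I₂ : ℝ) =
      (G P₁ - G Q₁) - (G P₂ - G Q₂) + 2 * Complex.I * (ρ * √ρ * (I₁ - I₂) : ℝ) := by
    push_cast at h3 ⊢
    linear_combination h3
  have hsρ : √ρ ≤ 1 := Real.sqrt_le_one.mpr (by linarith)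
  have k4 : ‖2 * Complex.I * (ρ * √ρ * (I₁ - I₂) : ℝ)‖ ≤ rexp (0.27 * μ) := by
    rw [norm_mul, norm_mul, Complex.norm_I, Complex.norm_real, Real.norm_eq_abs, abs_mul, abs_mul,
      abs_of_pos hρ, abs_of_nonneg (Real.sqrt_nonneg _)]
    have : rexp (μ / 9) ≤ rexp (0.27 * μ) := by
      gcongr
      linarith
    calc ‖(2 : ℂ)‖ * 1 * (ρ * √ρ * |I₁ - I₂|) ≤ 2 * 1 * (0.05 * 1 * (5 * rexp (μ / 9))) := by
          rw [Complex.norm_ofNat]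
          gcongr
      _ ≤ _ := by
        have := exp_pos (μ / 9)
        linarith
  rw [h2, e5]
  refine (norm_add_le _ _).trans ?_
  have := norm_sub_le (G P₁ - G Q₁) (G P₂ - G Q₂)
  linarith

end BesselIntegral

section MajorArc
open ModularForm UpperHalfPlane

lemma csqrt_I_inv_mul_csqrt {τ : ℂ} (hτ : 0 < τ.im) :
    (Complex.sqrt Complex.I)⁻¹ * Complex.sqrt τ =
      (√(2 * π) : ℂ)⁻¹ * (-(2 * π * Complex.I * τ)) ^ (2⁻¹ : ℂ) := by
  have h0 : τ ≠ 0 := by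
    rintro rfl
    simp at hτ
  have harg := Complex.arg_mem_Ioc τ
  have harg0 : 0 ≤ τ.arg := Complex.arg_nonneg_iff.mpr hτ.le
  have hlog : Complex.log (-(2 * π * Complex.I * τ)) =
      (Real.log (2 * π) : ℂ) + (Complex.log τ - Complex.log Complex.I) := by
    rw [show -(2 * π * Complex.I * τ) = ((2 * π : ℝ) : ℂ) * (τ * (-Complex.I)) by push_cast; ring,
      Complex.log_ofReal_mul (by positivity) (mul_ne_zero h0 (by simp)),
      Complex.log_mul_eq_add_log_iff h0 (by simp) |>.mpr, Complex.log_neg_I, Complex.log_I]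
    · ring
    · rw [Complex.arg_neg_I]
      constructor <;> linarith [harg.2, pi_pos]
  have hI : Complex.sqrt Complex.I = Complex.exp (Complex.log Complex.I / 2) := by
    rw [Complex.sqrt, Complex.cpow_def_of_ne_zero Complex.I_ne_zero]
    ring_nf
  have ht : Complex.sqrt τ = Complex.exp (Complex.log τ / 2) := by
    rw [Complex.sqrt, Complex.cpow_def_of_ne_zero h0]
    ring_nf
  have hpi : (√(2 * π) : ℂ) = Complex.exp ((Real.log (2 * π) : ℂ) / 2) := by
    rw [Real.sqrt_eq_rpow, Real.rpow_def_of_pos (by positivity)]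
    push_cast
    ring_nf
  rw [Complex.cpow_def_of_ne_zero (by simp [h0]), hlog, hI, ht, hpi, ← Complex.exp_neg,
    ← Complex.exp_neg, ← Complex.exp_add, ← Complex.exp_add]
  ring_nf

lemma partitionIntegrand_eq_besselIntegrand {n : ℕ} {μ ρ : ℝ} (hρ : ρ ≠ 0)
    (h1 : ρ * μ = π ^ 2 / 3) (h2 : μ = 2 * ρ * (n - 1 / 24)) {τ : ℂ} (hτ : 0 < τ.im) :
    partitionIntegrand n τ = (√(2 * π) : ℂ)⁻¹ * besselIntegrand μ ρ (-(2 * π * Complex.I * τ)) *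
      (∏' k : ℕ, (1 - Complex.exp (2 * π * Complex.I * (-1 / τ)) ^ (k + 1)))⁻¹ := by
  have h0 : τ ≠ 0 := by
    rintro rfl
    simp at hτ
  have hS := eta_comp_eq_csqrt_I_inv (x := τ) hτ
  simp only [Function.comp_apply, Pi.smul_apply, Pi.mul_apply, smul_eq_mul] at hS
  rw [← mul_assoc, csqrt_I_inv_mul_csqrt hτ] at hS
  have hτ' : 0 < (-1 / τ).im := by
    rw [neg_div, one_div, Complex.neg_im, Complex.inv_im]
    have := Complex.normSq_pos.mpr h0
    rw [neg_div, neg_neg]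
    positivity
  have hη' := eta_ne_zero hτ'
  have hη := eta_ne_zero hτ
  have h3 : (η τ)⁻¹ = (√(2 * π) : ℂ)⁻¹ * (-(2 * π * Complex.I * τ)) ^ (2⁻¹ : ℂ) *
      (η (-1 / τ))⁻¹ := by
    rw [hS, mul_inv, ← mul_assoc, mul_inv_cancel₀, one_mul]
    intro h
    rw [h, zero_mul] at hS
    exact hη' hS
  have h4 : (η (-1 / τ))⁻¹ = Complex.exp (2 * π * Complex.I / (24 * τ)) *
      (∏' k : ℕ, (1 - Complex.exp (2 * π * Complex.I * (-1 / τ)) ^ (k + 1)))⁻¹ := by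
    rw [eta, mul_inv]
    simp_rw [eta_q_eq_pow]
    congr 1
    rw [Function.Periodic.qParam, ← Complex.exp_neg]
    congr 1
    push_cast
    field_simp
  rw [partitionIntegrand, div_eq_mul_inv, h3, h4, besselIntegrand]
  have h5 : (μ : ℂ) / 2 * (ρ / -(2 * π * Complex.I * τ) + -(2 * π * Complex.I * τ) / ρ) =
      -(2 * π * Complex.I * (n - 1 / 24) * τ) + 2 * π * Complex.I / (24 * τ) := by
    have h1' : (ρ : ℂ) * μ = π ^ 2 / 3 := by exact_mod_cast h1
    have h2' : (μ : ℂ) = 2 * ρ * (n - 1 / 24) := by rw [h2]; push_cast; ring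
    have e1 : (μ : ℂ) / 2 * (ρ / -(2 * π * Complex.I * τ)) = 2 * π * Complex.I / (24 * τ) := by
      have : (μ : ℂ) / 2 * (ρ / -(2 * π * Complex.I * τ)) =
        (ρ * μ) / (-(4 * π * Complex.I * τ)) := by ring
      rw [this, h1']
      have hp : (π : ℂ) ≠ 0 := by exact_mod_cast pi_ne_zero
      field_simp
      ring_nf
      simp
    have e2 : (μ : ℂ) / 2 * (-(2 * π * Complex.I * τ) / ρ) =
        -(2 * π * Complex.I * (n - 1 / 24) * τ) := by
      have : (ρ : ℂ) ≠ 0 := by exact_mod_cast hρ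
      rw [h2']
      field_simp
    rw [mul_add, e1, e2]
    ring
  rw [h5, Complex.exp_add]
  ring

lemma norm_partitionIntegrand_sub_le {n : ℕ} {μ ρ x y : ℝ} (hμ : 0 < μ) (hρ : 0 < ρ)
    (h1 : ρ * μ = π ^ 2 / 3) (h2 : μ = 2 * ρ * (n - 1 / 24)) (hy : 0 < y) (hy1 : y ≤ 1)
    (hρy : ρ = 4 * π * y) (hxy : x ^ 2 + y ^ 2 ≤ y) :
    ‖partitionIntegrand n (x + y * Complex.I) -
      (√(2 * π) : ℂ)⁻¹ * besselIntegrand μ ρ (ρ / 2 - 2 * π * x * Complex.I)‖ ≤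
      rexp (μ / 4) := by
  set τ : ℂ := x + y * Complex.I with hτdef
  have hre : τ.re = x := by simp [τ]
  have him : τ.im = y := by simp [τ]
  have hτ : 0 < τ.im := by rwa [him]
  have hns : Complex.normSq τ = x ^ 2 + y ^ 2 := by
    rw [Complex.normSq_apply, hre, him]; ring
  have hnpos : 0 < x ^ 2 + y ^ 2 := by positivity
  have hY : (-1 / τ).im = y / (x ^ 2 + y ^ 2) := by
    rw [neg_div, one_div, Complex.neg_im, Complex.inv_im, hns, him]
    ring
  have hY1 : 1 ≤ (-1 / τ).im := by
    rw [hY, le_div_iff₀ hnpos]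
    linarith
  have hq := norm_cexp_two_pi_I_mul_le (τ := -1 / τ) (by linarith)
  set q := Complex.exp (2 * π * Complex.I * (-1 / τ))
  set P := ∏' k : ℕ, (1 - q ^ (k + 1)) with hP
  have hP1 := norm_tprod_one_sub_pow_sub_one_le hq
  have hP2 := inv_norm_tprod_one_sub_pow_le hq
  have hqn : ‖q‖ = rexp (-(2 * π * (-1 / τ).im)) := norm_cexp_two_pi_I_mul _
  have hP0 : P ≠ 0 := by
    intro h0
    rw [← hP, h0] at hP1
    norm_num at hP1
    linarith
  have hw : (ρ : ℂ) / 2 - 2 * π * x * Complex.I = -(2 * π * Complex.I * τ) := by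
    rw [hρy, hτdef]
    push_cast
    linear_combination (2 * π * y : ℂ) * Complex.I_sq
  rw [hw, partitionIntegrand_eq_besselIntegrand hρ.ne' h1 h2 hτ, ← mul_sub_one]
  have hB : ‖(√(2 * π) : ℂ)⁻¹ * besselIntegrand μ ρ (-(2 * π * Complex.I * τ))‖ ≤
      rexp (μ / 4) * rexp (π / 12 * (-1 / τ).im) := by
    have hw0 : -(2 * π * Complex.I * τ) ≠ 0 := by
      have : τ ≠ 0 := by
        intro h
        rw [h] at hτ
        simp at hτ
      simp [this, pi_ne_zero]
    rw [besselIntegrand, ← mul_assoc, norm_mul, Complex.norm_exp, ← Real.exp_add]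
    have e1 : ((μ : ℂ) / 2 * (ρ / -(2 * π * Complex.I * τ) + -(2 * π * Complex.I * τ) / ρ)).re =
        μ / 4 + π / 12 * (-1 / τ).im := by
      rw [re_besselIntegrand_exponent, ← hw, hY]
      have r1 : ((ρ : ℂ) / 2 - 2 * π * x * Complex.I).re = ρ / 2 := by simp
      have r2 : ((ρ : ℂ) / 2 - 2 * π * x * Complex.I).im = -(2 * π * x) := by simp
      have r3 : (ρ / 2) ^ 2 + (-(2 * π * x)) ^ 2 = 4 * π ^ 2 * (x ^ 2 + y ^ 2) := by
        rw [hρy]; ring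
      have r4 : ρ / 2 / ρ = 1 / 2 := by field_simp
      have r5 : μ / 2 * (ρ * (ρ / 2) / (4 * π ^ 2 * (x ^ 2 + y ^ 2))) =
          (ρ * μ) * ρ / (16 * π ^ 2 * (x ^ 2 + y ^ 2)) := by
        field_simp; norm_num
      rw [r1, r2, r3, r4, mul_add, r5, h1, hρy]
      field_simp
      ring
    have e2 : ‖(√(2 * π) : ℂ)⁻¹ * (-(2 * π * Complex.I * τ)) ^ (2⁻¹ : ℂ)‖ ≤ 1 := by
      rw [show (2⁻¹ : ℂ) = ((2⁻¹ : ℝ) : ℂ) by push_cast; rfl, norm_mul,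
        Complex.norm_cpow_of_ne_zero hw0]
      simp only [Complex.ofReal_re, Complex.ofReal_im, mul_zero, Real.exp_zero, div_one]
      have e3 : ‖-(2 * π * Complex.I * τ)‖ ≤ 2 * π := by
        have : ‖τ‖ ≤ 1 := by
          rw [← sq_le_one_iff₀ (norm_nonneg _), Complex.sq_norm, hns]
          linarith
        rw [norm_neg, norm_mul, norm_mul, norm_mul, Complex.norm_I, Complex.norm_ofNat,
          Complex.norm_real, norm_of_nonneg pi_pos.le]
        have := pi_pos
        nlinarith [norm_nonneg τ]
      rw [norm_inv, Complex.norm_real, norm_of_nonneg (by positivity), Real.sqrt_eq_rpow]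
      rw [inv_mul_le_iff₀ (by positivity), mul_one, one_div]
      gcongr
    rw [e1]
    calc _ ≤ 1 * rexp (μ / 4 + π / 12 * (-1 / τ).im) := by gcongr
      _ = _ := one_mul _
  have hPsub : ‖P⁻¹ - 1‖ ≤ 1.005 * (1.02 * rexp (-(2 * π * (-1 / τ).im))) := by
    have : P⁻¹ - 1 = P⁻¹ * (-(P - 1)) := by field_simp; ring
    rw [this, norm_mul, norm_inv, norm_neg, ← hqn]
    gcongr
  rw [norm_mul]
  calc _ ≤ rexp (μ / 4) * rexp (π / 12 * (-1 / τ).im) *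
        (1.005 * (1.02 * rexp (-(2 * π * (-1 / τ).im)))) := by gcongr
    _ = rexp (μ / 4) * (1.005 * 1.02 * rexp (-(23 * π / 12 * (-1 / τ).im))) := by
      rw [mul_assoc, mul_left_comm (rexp (π / 12 * (-1 / τ).im)),
        mul_left_comm (rexp (π / 12 * (-1 / τ).im)), ← Real.exp_add]
      ring_nf
    _ ≤ rexp (μ / 4) * (1.005 * 1.02 * (1 / 210)) := by
      gcongr
      apply exp_neg_le_one_div_210
      nlinarith [pi_gt_three]
    _ ≤ rexp (μ / 4) := by
      have := exp_pos (μ / 4)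
      linarith

end MajorArc

section MinorArc
open ModularForm MeasureTheory

lemma rpow_mul_exp_div_one_add_le {μ s : ℝ} (hμ : 0 ≤ μ) (hs : 0 ≤ s) (hs1 : s ≤ 5 / 4) :
    (1 + s) ^ (1 / 4 : ℝ) * rexp (μ / 4 / (1 + s)) ≤
      rexp (μ / 4) * rexp (-((0.16 * μ - 0.25) * s)) +
        1.225 * (rexp 1 * rexp (0.16 * μ) * rexp (-(0.8 * s))) := by
  rcases le_or_gt s (9 / 16) with h | h
  · have h1 : (1 + s) ^ (1 / 4 : ℝ) ≤ rexp (s / 4) := by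
      calc (1 + s) ^ (1 / 4 : ℝ) ≤ rexp s ^ (1 / 4 : ℝ) := by
            gcongr
            linarith [add_one_le_exp s]
        _ = rexp (s / 4) := by
          rw [← Real.exp_mul]
          ring_nf
    have h2 : μ / 4 / (1 + s) ≤ μ / 4 * (1 - 0.64 * s) := by
      rw [div_eq_mul_inv (μ / 4)]
      gcongr
      rw [inv_le_iff_one_le_mul₀ (by linarith)]
      nlinarith
    calc _ ≤ rexp (s / 4) * rexp (μ / 4 * (1 - 0.64 * s)) := by gcongr
      _ = rexp (μ / 4) * rexp (-((0.16 * μ - 0.25) * s)) := by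
        rw [← Real.exp_add, ← Real.exp_add]
        ring_nf
      _ ≤ _ := le_add_of_nonneg_right (by positivity)
  · have h1 : (1 + s) ^ (1 / 4 : ℝ) ≤ 1.225 := by
      calc (1 + s) ^ (1 / 4 : ℝ) ≤ (1.225 ^ 4) ^ (1 / 4 : ℝ) := by
            gcongr
            norm_num
            linarith
        _ = _ := by
          rw [← rpow_natCast, ← rpow_mul (by norm_num)]
          norm_num
    have h2 : μ / 4 / (1 + s) ≤ 0.16 * μ := by
      rw [div_le_iff₀ (by linarith)]
      nlinarith
    have h3 : 1 ≤ rexp 1 * rexp (-(0.8 * s)) := by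
      rw [← Real.exp_add, Real.one_le_exp_iff]
      linarith
    calc _ ≤ 1.225 * rexp (0.16 * μ) := by gcongr
      _ ≤ 1.225 * rexp (0.16 * μ) * (rexp 1 * rexp (-(0.8 * s))) :=
        le_mul_of_one_le_right (by positivity) h3
      _ = 1.225 * (rexp 1 * rexp (0.16 * μ) * rexp (-(0.8 * s))) := by ring
      _ ≤ _ := le_add_of_nonneg_left (by positivity)

lemma intervalIntegral_exp_neg_mul_sq_le {a y m α β : ℝ} (ha : 0 < a) (hy : 0 < y) (h : α ≤ β) :
    ∫ x in α..β, rexp (-(a * ((x - m) ^ 2 / y ^ 2))) ≤ y * √(π / a) := by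
  have e : ∀ x, rexp (-(a * ((x - m) ^ 2 / y ^ 2))) = rexp (-(a / y ^ 2) * (x - m) ^ 2) := by
    intro x
    congr 1
    field_simp
  simp_rw [e]
  have hi : Integrable fun x ↦ rexp (-(a / y ^ 2) * (x - m) ^ 2) :=
    (integrable_exp_neg_mul_sq (show 0 < a / y ^ 2 by positivity)).comp_sub_right m
  calc _ ≤ ∫ x, rexp (-(a / y ^ 2) * (x - m) ^ 2) := by
        rw [intervalIntegral.integral_of_le h]
        exact setIntegral_le_integral hi (ae_of_all _ fun _ ↦ (exp_pos _).le)
    _ = y * √(π / a) := by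
      rw [integral_sub_right_eq_self (fun x ↦ rexp (-(a / y ^ 2) * x ^ 2)), integral_gaussian,
        ← Real.sqrt_sq hy.le, ← Real.sqrt_mul (by positivity), Real.sq_sqrt (by positivity)]
      congr 1
      field_simp

lemma inv_norm_eta_le_of_minor' {x y μ X : ℝ} (hμ : 75 ≤ μ) (hμy : μ * y = π / 12)
    (hX : 0 < X) (hXy : X ^ 2 + y ^ 2 = y) (h1 : X ≤ x) (h2 : x ≤ 1 - X) :
    ‖η (x + y * Complex.I)‖⁻¹ ≤ 1.042 * y ^ (1 / 4 : ℝ) * rexp (μ / 9) +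
      1.005 * √(2 * y) * (rexp (μ / 4) *
        rexp (-((0.16 * μ - 0.25) * ((x - 1 / 2) ^ 2 / y ^ 2))) +
        1.225 * (rexp 1 * rexp (0.16 * μ) * rexp (-(0.8 * ((x - 1 / 2) ^ 2 / y ^ 2))))) := by
  have hμ0 : 0 < μ := by linarith
  have hy : 0 < y := by
    have : 0 < μ * y := by rw [hμy]; positivity
    exact pos_of_mul_pos_right this hμ0.le
  have hy' : y ≤ 1 / 36 := by
    have := pi_lt_four
    nlinarith
  have e : π = 12 * (μ * y) := by linarith
  rcases inv_norm_eta_le_of_minor hy hX hXy h1 h2 hy' with h | ⟨hu, h⟩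
  · refine h.trans ?_
    have : π / (108 * y) = μ / 9 := by
      rw [e]
      field_simp
      norm_num
    rw [this]
    exact le_add_of_nonneg_right (by positivity)
  · refine h.trans ?_
    set s := (x - 1 / 2) ^ 2 / y ^ 2
    have hs : 0 ≤ s := by positivity
    have hs1 : s ≤ 5 / 4 := by
      rw [div_le_iff₀ (by positivity)]
      exact hu
    have hsy : (x - 1 / 2) ^ 2 = s * y ^ 2 := by
      simp only [s]
      field_simp
    have e1 : 4 * ((x - 1 / 2) ^ 2 + y ^ 2) = (2 * y) ^ 2 * (1 + s) := by
      rw [hsy]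
      ring
    have e2 : π / 12 * (y / ((2 * y) ^ 2 * (1 + s))) = μ / 4 / (1 + s) := by
      rw [e]
      field_simp
      norm_num
    have e3 : ((2 * y) ^ 2) ^ (1 / 4 : ℝ) = √(2 * y) := by
      rw [Real.sqrt_eq_rpow, ← rpow_natCast, ← rpow_mul (by positivity)]
      norm_num
    rw [e1, e2, mul_rpow (by positivity) (by positivity), e3, mul_assoc (√(2 * y)),
      mul_assoc (1.005 : ℝ)]
    refine le_trans ?_ (le_add_of_nonneg_left (by positivity))
    gcongr
    exact rpow_mul_exp_div_one_add_le hμ0.le hs hs1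

lemma norm_integral_partitionIntegrand_minor_le {n : ℕ} {μ y X : ℝ} (hμ : 75 ≤ μ)
    (hμy : μ * y = π / 12) (hn : 2 * π * (n - 1 / 24) * y = μ / 4)
    (hX : 0 < X) (hXy : X ^ 2 + y ^ 2 = y) :
    ‖∫ x in X..1 - X, partitionIntegrand n (x + y * Complex.I)‖ ≤
      rexp (μ / 4) * (1.042 * y ^ (1 / 4 : ℝ) * rexp (μ / 9) +
        1.005 * √(2 * y) * (rexp (μ / 4) * (y * √(π / (0.16 * μ - 0.25))) +
        1.225 * (rexp 1 * rexp (0.16 * μ) * (y * √(π / 0.8))))) := by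
  have hμ0 : 0 < μ := by linarith
  have hy : 0 < y := by
    have : 0 < μ * y := by rw [hμy]; positivity
    exact pos_of_mul_pos_right this hμ0.le
  have hy' : y ≤ 1 / 36 := by
    have := pi_lt_four
    nlinarith
  have hX1 : X ≤ 1 - X := by nlinarith
  have hnorm : ∀ x : ℝ, ‖partitionIntegrand n (x + y * Complex.I)‖ =
      rexp (μ / 4) * ‖η (x + y * Complex.I)‖⁻¹ := by
    intro x
    rw [partitionIntegrand, norm_div, Complex.norm_exp, div_eq_mul_inv, ← hn]
    congr 2
    simp
  set A : ℝ → ℝ := fun x ↦ rexp (-((0.16 * μ - 0.25) * ((x - 1 / 2) ^ 2 / y ^ 2)))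
  set B : ℝ → ℝ := fun x ↦ rexp (-(0.8 * ((x - 1 / 2) ^ 2 / y ^ 2)))
  have hA : Continuous A := by fun_prop
  have hB : Continuous B := by fun_prop
  have h1 := intervalIntegral.norm_integral_le_of_norm_le (μ := volume) hX1
    (f := fun x : ℝ ↦ partitionIntegrand n (x + y * Complex.I))
    (g := fun x ↦ rexp (μ / 4) * (1.042 * y ^ (1 / 4 : ℝ) * rexp (μ / 9) +
      1.005 * √(2 * y) * (rexp (μ / 4) * A x +
        1.225 * (rexp 1 * rexp (0.16 * μ) * B x))))
    (ae_of_all _ fun x hx ↦ by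
      rw [hnorm]
      gcongr
      exact inv_norm_eta_le_of_minor' hμ hμy hX hXy hx.1.le hx.2)
    (Continuous.intervalIntegrable (by fun_prop) _ _)
  refine h1.trans ?_
  rw [intervalIntegral.integral_const_mul, intervalIntegral.integral_add, 
    intervalIntegral.integral_const, intervalIntegral.integral_const_mul,
    intervalIntegral.integral_add, intervalIntegral.integral_const_mul,
    intervalIntegral.integral_const_mul, intervalIntegral.integral_const_mul]
  · have iA : ∫ x in X..1 - X, A x ≤ y * √(π / (0.16 * μ - 0.25)) :=
      intervalIntegral_exp_neg_mul_sq_le (by linarith) hy hX1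
    have iB : ∫ x in X..1 - X, B x ≤ y * √(π / 0.8) :=
      intervalIntegral_exp_neg_mul_sq_le (by norm_num) hy hX1
    have i1 : (1 - X - X) • (1.042 * y ^ (1 / 4 : ℝ) * rexp (μ / 9)) ≤
        1.042 * y ^ (1 / 4 : ℝ) * rexp (μ / 9) := by
      rw [smul_eq_mul]
      exact mul_le_of_le_one_left (by positivity) (by linarith)
    gcongr
  all_goals exact Continuous.intervalIntegrable (by fun_prop) _ _

end MinorArc

section Assembly
open MeasureTheory

lemma sq_mul_exp_neg_le {μ a : ℝ} (hμ : 75 ≤ μ) (ha : 2 / 75 ≤ a) :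
    μ ^ 2 * rexp (-(a * μ)) ≤ 5625 * rexp (-(a * 75)) := by
  have h1 : μ ≤ 75 * rexp ((μ - 75) / 75) := by
    have := add_one_le_exp ((μ - 75) / 75)
    linarith
  calc μ ^ 2 * rexp (-(a * μ)) ≤ (75 * rexp ((μ - 75) / 75)) ^ 2 * rexp (-(a * μ)) := by gcongr
    _ = 5625 * rexp (2 * ((μ - 75) / 75) + -(a * μ)) := by
      rw [mul_pow, ← Real.exp_nat_mul, Real.exp_add]
      push_cast
      ring
    _ ≤ _ := by
      gcongr
      nlinarith

lemma norm_sub_le_of_majorArc {n : ℕ} {μ ρ y X : ℝ} (hμ : 75 ≤ μ)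
    (h1 : ρ * μ = π ^ 2 / 3) (h2 : μ = 2 * ρ * (n - 1 / 24)) (hρy : ρ = 4 * π * y)
    (hX : 0 < X) (hXy : X ^ 2 + y ^ 2 = y) :
    ‖(∫ x in (-X)..X, partitionIntegrand n (x + y * Complex.I)) -
      (π ^ 2 / (6 * √3 * μ ^ 2) * (1 - 1 / μ) * rexp μ : ℝ)‖ ≤ 2 * rexp (0.27 * μ) := by
  have hμ0 : 0 < μ := by linarith
  have hρ : 0 < ρ := by
    have : 0 < ρ * μ := by rw [h1]; positivity
    exact pos_of_mul_pos_left this hμ0.le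
  have hp3 := pi_gt_three
  have hp := pi_lt_d2
  have hy : 0 < y := by
    have : 0 < 4 * π * y := by rwa [← hρy]
    exact pos_of_mul_pos_right this (by positivity)
  have hπ2 : π ^ 2 ≤ 9.9225 := by nlinarith
  have hρ1 : ρ ≤ 0.0441 := by nlinarith
  have hy1 : y ≤ 0.0037 := by nlinarith
  have hyx : 0.99 * y ≤ X ^ 2 := by nlinarith
  have hXle : X ≤ 0.07 := by
    have : X ^ 2 ≤ 0.07 ^ 2 := by nlinarith
    exact (sq_le_sq₀ hX.le (by norm_num)).mp this
  have hXge : 8 * y ≤ X := by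
    refine (sq_le_sq₀ (by positivity) hX.le).mp ?_
    nlinarith
  have key := integral_besselIntegrand_approx hμ hρ (by linarith) hX (by rw [hρy]; nlinarith)
    (by nlinarith)
  set J := ∫ x in (-X)..X, besselIntegrand μ ρ (ρ / 2 - 2 * π * x * Complex.I)
  have hcont1 : Continuous fun x : ℝ ↦ partitionIntegrand n (x + y * Complex.I) :=
    (continuousOn_partitionIntegrand n).comp_continuous (by fun_prop) fun x ↦ by simpa using hy
  have hcont2 : Continuous fun x : ℝ ↦ besselIntegrand μ ρ (ρ / 2 - 2 * π * x * Complex.I) := by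
    rw [continuous_iff_continuousAt]
    intro x
    exact ContinuousAt.comp (f := fun x : ℝ ↦ (ρ : ℂ) / 2 - 2 * π * x * Complex.I)
      (differentiableAt_besselIntegrand μ ρ (by simpa using hρ)).continuousAt (by fun_prop)
  have hcont3 : Continuous fun x : ℝ ↦ (√(2 * π) : ℂ)⁻¹ *
      besselIntegrand μ ρ (ρ / 2 - 2 * π * x * Complex.I) := continuous_const.mul hcont2
  have e1 : ‖(∫ x in (-X)..X, partitionIntegrand n (x + y * Complex.I)) -
      (√(2 * π) : ℂ)⁻¹ * J‖ ≤ rexp (0.27 * μ) := by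
    rw [← intervalIntegral.integral_const_mul, ← intervalIntegral.integral_sub
      (hcont1.intervalIntegrable _ _) (hcont3.intervalIntegrable _ _)]
    refine (intervalIntegral.norm_integral_le_of_norm_le_const (C := rexp (μ / 4))
      fun x hx ↦ ?_).trans ?_
    · rw [Set.uIoc_of_le (by linarith)] at hx
      refine norm_partitionIntegrand_sub_le hμ0 hρ h1 h2 hy (by linarith) hρy ?_
      have hXy' := hXy.ge
      have : x ^ 2 ≤ X ^ 2 := sq_le_sq' hx.1.le hx.2
      linarith
    · rw [abs_of_nonneg (by linarith)]
      have : rexp (μ / 4) ≤ rexp (0.27 * μ) := by gcongr; linarith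
      nlinarith [exp_pos (μ / 4)]
  have hJ : ‖J - ((ρ * √ρ * ((1 - 1 / μ) * √(π / (2 * μ)) * rexp μ) / π : ℝ) : ℂ)‖ ≤
      9 / (2 * π) * rexp (0.27 * μ) := by
    have hpc : (π : ℂ) ≠ 0 := by exact_mod_cast pi_ne_zero
    have : J - ((ρ * √ρ * ((1 - 1 / μ) * √(π / (2 * μ)) * rexp μ) / π : ℝ) : ℂ) =
        (2 * π * Complex.I)⁻¹ * ((2 * π * Complex.I) * J -
          2 * Complex.I * (ρ * √ρ * ((1 - 1 / μ) * √(π / (2 * μ)) * rexp μ) : ℝ)) := by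
      generalize ρ * √ρ * ((1 - 1 / μ) * √(π / (2 * μ)) * rexp μ) = M
      push_cast
      have := Complex.I_ne_zero
      field_simp
    rw [this, norm_mul, norm_inv, norm_mul, norm_mul, Complex.norm_I, Complex.norm_ofNat,
      Complex.norm_real, norm_of_nonneg pi_pos.le, mul_one]
    calc _ ≤ (2 * π)⁻¹ * (9 * rexp (0.27 * μ)) := by gcongr
      _ = _ := by ring
  have hT : π ^ 2 / (6 * √3 * μ ^ 2) * (1 - 1 / μ) * rexp μ =
      (√(2 * π))⁻¹ * (ρ * √ρ * ((1 - 1 / μ) * √(π / (2 * μ)) * rexp μ) / π) := by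
    have hs : √ρ * √(π / (2 * μ)) = √(2 * π) * (π / (2 * √3 * μ)) := by
      rw [← Real.sqrt_mul hρ.le, show π / (2 * √3 * μ) = √(π ^ 2 / (12 * μ ^ 2)) from ?_,
        ← Real.sqrt_mul (by positivity)]
      · congr 1
        field_simp
        linear_combination 12 * h1
      · rw [Real.sqrt_div (by positivity), Real.sqrt_sq pi_pos.le, Real.sqrt_mul (by norm_num),
          Real.sqrt_sq hμ0.le, show (12 : ℝ) = 2 ^ 2 * 3 by norm_num, Real.sqrt_mul (by norm_num),
          Real.sqrt_sq (by norm_num)]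
    have hρe : ρ = π ^ 2 / (3 * μ) := by
      field_simp
      linarith
    calc _ = (√(2 * π))⁻¹ * (ρ * (√(2 * π) * (π / (2 * √3 * μ))) * (1 - 1 / μ) * rexp μ / π) := by
          rw [hρe]
          field_simp
          ring
      _ = _ := by rw [← hs]; ring
  have e2 : ‖(√(2 * π) : ℂ)⁻¹ * J - (π ^ 2 / (6 * √3 * μ ^ 2) * (1 - 1 / μ) * rexp μ : ℝ)‖ ≤
      rexp (0.27 * μ) := by
    rw [hT, Complex.ofReal_mul, Complex.ofReal_inv, ← mul_sub, norm_mul, norm_inv,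
      Complex.norm_real, norm_of_nonneg (by positivity)]
    have h22 : 2 ≤ √(2 * π) := Real.le_sqrt_of_sq_le (by linarith)
    calc _ ≤ (2 : ℝ)⁻¹ * (9 / (2 * 3) * rexp (0.27 * μ)) := by
          gcongr
          refine hJ.trans ?_
          gcongr
      _ ≤ _ := by linarith [exp_pos (0.27 * μ)]
  calc _ ≤ _ := norm_sub_le_norm_sub_add_norm_sub _ ((√(2 * π) : ℂ)⁻¹ * J) _
    _ ≤ _ := by linarith

lemma exp_add_ge {k : ℕ} {t : ℝ} (ht : 0 ≤ t) : 2.718 ^ k * (1 + t + t ^ 2 / 2) ≤ rexp (k + t) := by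
  rw [Real.exp_add, ← mul_one (k : ℝ), Real.exp_nat_mul]
  gcongr
  · linarith [exp_one_gt_d9]
  · exact quadratic_le_exp_of_nonneg ht

lemma minorArc_bound_le {μ y : ℝ} (hμ : 75 ≤ μ) (hμy : μ * y = π / 12) :
    μ ^ 2 * (rexp (μ / 4) * (1.042 * y ^ (1 / 4 : ℝ) * rexp (μ / 9) +
        1.005 * √(2 * y) * (rexp (μ / 4) * (y * √(π / (0.16 * μ - 0.25))) +
        1.225 * (rexp 1 * rexp (0.16 * μ) * (y * √(π / 0.8)))))) + μ ^ 2 * (2 * rexp (0.27 * μ)) ≤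
      0.93 * rexp (μ / 2) := by
  have hμ0 : 0 < μ := by linarith
  have hy : 0 < y := by
    have : 0 < μ * y := by rw [hμy]; positivity
    exact pos_of_mul_pos_right this hμ0.le
  have hp := pi_lt_d2
  have hp' := pi_lt_d4
  have hy1 : y ≤ 0.0035 := by nlinarith
  have hE := exp_pos (μ / 2)
  have t1 : μ ^ 2 * rexp (-(5 / 36 * μ)) ≤ 0.1702 := by
    refine (sq_mul_exp_neg_le hμ (by norm_num)).trans ?_
    have := exp_add_ge (k := 10) (t := 5 / 12) (by norm_num)
    rw [Real.exp_neg, show (5 / 36 * 75 : ℝ) = (10 : ℕ) + 5 / 12 by norm_num,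
      ← div_eq_mul_inv, div_le_iff₀ (exp_pos _)]
    norm_num at this ⊢
    linarith
  have t2 : μ ^ 2 * rexp (-(0.09 * μ)) ≤ 6.88 := by
    refine (sq_mul_exp_neg_le hμ (by norm_num)).trans ?_
    have := exp_add_ge (k := 6) (t := 3 / 4) (by norm_num)
    rw [Real.exp_neg, show (0.09 * 75 : ℝ) = (6 : ℕ) + 3 / 4 by norm_num,
      ← div_eq_mul_inv, div_le_iff₀ (exp_pos _)]
    norm_num at this ⊢
    linarith
  have t3 : μ ^ 2 * rexp (-(0.23 * μ)) ≤ 0.0003 := by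
    refine (sq_mul_exp_neg_le hμ (by norm_num)).trans ?_
    have := exp_add_ge (k := 17) (t := 1 / 4) (by norm_num)
    rw [Real.exp_neg, show (0.23 * 75 : ℝ) = (17 : ℕ) + 1 / 4 by norm_num,
      ← div_eq_mul_inv, div_le_iff₀ (exp_pos _)]
    norm_num at this ⊢
    linarith
  have y4 : y ^ (1 / 4 : ℝ) ≤ 0.25 := by
    calc y ^ (1 / 4 : ℝ) ≤ (0.25 ^ 4) ^ (1 / 4 : ℝ) := by
          gcongr
          norm_num at hy1 ⊢
          linarith
      _ = 0.25 := by
        rw [← rpow_natCast, ← rpow_mul (by norm_num)]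
        norm_num
  have y2 : √(2 * y) ≤ 0.0837 := by
    rw [Real.sqrt_le_iff]
    constructor
    · norm_num
    · norm_num at hy1 ⊢
      linarith
  have p8 : √(π / 0.8) ≤ 1.985 := by
    rw [Real.sqrt_le_iff]
    constructor
    · norm_num
    · rw [div_le_iff₀ (by norm_num)]
      norm_num at hp ⊢
      linarith
  have c1 : √(2 * y) * √(π / (0.16 * μ - 0.25)) * (y * μ ^ 2) ≤ 0.849 := by
    have e1 : π / (0.16 * μ - 0.25) ≤ π / (0.1566 * μ) := by
      gcongr
      linarith
    have e2 : y = π / (12 * μ) := by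
      field_simp
      linarith
    have e3 : √(2 * y) * √(π / (0.16 * μ - 0.25)) ≤ 1.0317 * (π / μ) := by
      rw [← Real.sqrt_mul (by positivity), Real.sqrt_le_iff]
      refine ⟨by positivity, ?_⟩
      calc 2 * y * (π / (0.16 * μ - 0.25)) ≤ 2 * y * (π / (0.1566 * μ)) := by gcongr
        _ = 1 / (6 * 0.1566) * (π / μ) ^ 2 := by
          rw [e2]
          field_simp
          norm_num
        _ ≤ _ := by
          rw [mul_pow]
          gcongr
          norm_num
    have e4 : y * μ ^ 2 = π * μ / 12 := by linear_combination μ * hμy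
    calc _ ≤ 1.0317 * (π / μ) * (π * μ / 12) := by rw [e4]; gcongr
      _ = 1.0317 / 12 * π ^ 2 := by field_simp
      _ ≤ 1.0317 / 12 * 3.1416 ^ 2 := by gcongr
      _ ≤ _ := by norm_num
  have b1 : rexp (μ / 4) * rexp (μ / 9) = rexp (μ / 2) * rexp (-(5 / 36 * μ)) := by
    rw [← Real.exp_add, ← Real.exp_add]
    ring_nf
  have b2 : rexp (μ / 4) * rexp (μ / 4) = rexp (μ / 2) := by
    rw [← Real.exp_add]
    ring_nf
  have b3 : rexp (μ / 4) * rexp (0.16 * μ) = rexp (μ / 2) * rexp (-(0.09 * μ)) := by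
    rw [← Real.exp_add, ← Real.exp_add]
    ring_nf
  have b4 : rexp (0.27 * μ) = rexp (μ / 2) * rexp (-(0.23 * μ)) := by
    rw [← Real.exp_add]
    ring_nf
  calc _ = rexp (μ / 2) * (1.042 * (y ^ (1 / 4 : ℝ) * (μ ^ 2 * rexp (-(5 / 36 * μ)))) +
        1.005 * (√(2 * y) * √(π / (0.16 * μ - 0.25)) * (y * μ ^ 2)) +
        1.005 * 1.225 * (√(2 * y) * rexp 1 * y * √(π / 0.8) * (μ ^ 2 * rexp (-(0.09 * μ)))) +
        2 * (μ ^ 2 * rexp (-(0.23 * μ)))) := by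
        rw [b4]
        linear_combination (μ ^ 2 * 1.042 * y ^ (1 / 4 : ℝ)) * b1 +
          1.005 * (√(2 * y) * √(π / (0.16 * μ - 0.25)) * (y * μ ^ 2)) * b2 +
          1.005 * 1.225 * (√(2 * y) * rexp 1 * y * √(π / 0.8)) * μ ^ 2 * b3
    _ ≤ rexp (μ / 2) * (1.042 * (0.25 * 0.1702) + 1.005 * 0.849 +
        1.005 * 1.225 * (0.0837 * 2.7183 * 0.0035 * 1.985 * 6.88) + 2 * 0.0003) := by
      gcongr
      linarith [exp_one_lt_d9]
    _ ≤ rexp (μ / 2) * 0.93 := by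
      gcongr
      norm_num
    _ = _ := mul_comm _ _

/-- The principal term of the Hardy–Ramanujan–Rademacher series with an explicit error. -/
lemma abs_p_sub_le {n : ℕ} {μ : ℝ} (hμ : 75 ≤ μ) (hn : (n : ℝ) - 1 / 24 = 3 * μ ^ 2 / (2 * π ^ 2)) :
    |p n - π ^ 2 / (6 * √3 * μ ^ 2) * (1 - 1 / μ) * rexp μ| ≤ 0.93 * rexp (μ / 2) / μ ^ 2 := by
  have hμ0 : 0 < μ := by linarith
  obtain ⟨y, hy⟩ : ∃ y, y = π / (12 * μ) := ⟨_, rfl⟩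
  have hy0 : 0 < y := by rw [hy]; positivity
  have hμy : μ * y = π / 12 := by rw [hy]; field_simp
  have hy1 : y < 1 := by
    have := pi_lt_four
    nlinarith
  obtain ⟨X, hX⟩ : ∃ X, X = √(y - y ^ 2) := ⟨_, rfl⟩
  have hX0 : 0 < X := by
    rw [hX]
    apply Real.sqrt_pos.mpr
    nlinarith
  have hXy : X ^ 2 + y ^ 2 = y := by
    rw [hX, Real.sq_sqrt (by nlinarith)]
    ring
  have hM := norm_sub_le_of_majorArc (n := n) (ρ := 4 * π * y) hμ
    (by linear_combination 4 * π * hμy)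
    (by rw [hn, hy]; field_simp; norm_num) rfl hX0 hXy
  have hm := norm_integral_partitionIntegrand_minor_le (n := n) hμ hμy
    (by rw [hn, hy]; field_simp; norm_num) hX0 hXy
  have hcont : Continuous fun x : ℝ ↦ partitionIntegrand n (x + y * Complex.I) :=
    (continuousOn_partitionIntegrand n).comp_continuous (by fun_prop) fun x ↦ by simpa using hy0
  have hp := p_eq_intervalIntegral n hy0 (-X)
  rw [← intervalIntegral.integral_add_adjacent_intervals (hcont.intervalIntegrable (-X) X)
    (hcont.intervalIntegrable _ _), show -X + 1 = 1 - X by ring] at hp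
  rw [le_div_iff₀ (by positivity), ← Real.norm_eq_abs, ← Complex.norm_real, Complex.ofReal_sub, hp,
    add_sub_right_comm]
  refine le_trans ?_ (minorArc_bound_le hμ hμy)
  rw [mul_comm, ← mul_add, add_comm (rexp (μ / 4) * _)]
  gcongr
  exact (norm_add_le _ _).trans (add_le_add hM hm)

end Assembly

section BinomialSeries

/-- A recurrence of which `0` is the only solution of moderate growth. -/
lemma eq_zero_of_recurrence {z C K : ℝ} {x : ℕ → ℝ} (hz : 0 ≤ z) (hC : 0 ≤ C)
    (hzC : z * C ^ 2 = C - 1) (h3 : 3 * (z * C) < 1) (hx : ∀ i, |x i| ≤ K * 3 ^ i)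
    (hrec : ∀ i, x (i + 1) = x i + z * x (i + 2)) (h0 : x 0 = 2 * z * x 1) (i : ℕ) : x i = 0 := by
  have hd : ∀ i, x (i + 1) = C * x i := by
    intro i
    have h1 : ∀ j, x (i + 1) - C * x i = (z * C) ^ j * (x (i + j + 1) - C * x (i + j)) := by
      intro j
      induction j with
      | zero => simp
      | succ j ih =>
        rw [ih, pow_succ, mul_assoc]
        congr 1
        have := hrec (i + j)
        rw [show i + (j + 1) + 1 = i + j + 2 by ring, ← add_assoc]
        linear_combination C * this + x (i + j + 1) * hzC
    have h2 : ∀ j, |x (i + 1) - C * x i| ≤ K * 3 ^ i * (3 + C) * (3 * (z * C)) ^ j := by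
      intro j
      rw [h1 j, abs_mul, abs_of_nonneg (by positivity)]
      have h4 : |x (i + j + 1) - C * x (i + j)| ≤ K * 3 ^ (i + j + 1) + C * (K * 3 ^ (i + j)) := by
        refine (abs_sub _ _).trans (add_le_add (hx _) ?_)
        rw [abs_mul, abs_of_nonneg hC]
        gcongr
        exact hx _
      calc _ ≤ (z * C) ^ j * (K * 3 ^ (i + j + 1) + C * (K * 3 ^ (i + j))) := by gcongr
        _ = _ := by rw [mul_pow 3]; ring
    have h5 : Tendsto (fun j : ℕ ↦ K * 3 ^ i * (3 + C) * (3 * (z * C)) ^ j) atTop (𝓝 0) := by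
      simpa using (tendsto_pow_atTop_nhds_zero_of_lt_one (by positivity) h3).const_mul
        (K * 3 ^ i * (3 + C))
    have := ge_of_tendsto' h5 h2
    linarith [abs_nonpos_iff.mp this]
  have h6 : x 0 = 0 := by
    rw [hd 0] at h0
    have : 0 < 1 - 2 * (z * C) := by
      have : 0 ≤ z * C := by positivity
      linarith
    have h7 : (1 - 2 * (z * C)) * x 0 = 0 := by linarith
    exact (mul_eq_zero.mp h7).resolve_left this.ne'
  induction i with
  | zero => exact h6
  | succ i ih => rw [hd, ih, mul_zero]

lemma choose_mul_pow_le {z : ℝ} (hz : 0 ≤ z) (i k : ℕ) :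
    ((i + 2 * k).choose k : ℝ) * z ^ k ≤ 2 ^ i * (4 * z) ^ k := by
  have h : ((i + 2 * k).choose k : ℝ) ≤ 2 ^ (i + 2 * k) := by
    exact_mod_cast Nat.choose_le_two_pow _ _
  calc _ ≤ (2 : ℝ) ^ (i + 2 * k) * z ^ k := by gcongr
    _ = _ := by rw [pow_add, pow_mul, mul_pow]; norm_num; ring

lemma mul_choose_mul_pow_le {z : ℝ} (hz : 0 ≤ z) (i k : ℕ) :
    (k : ℝ) * (i + 2 * k).choose k * z ^ k ≤ 2 ^ i * (8 * z) ^ k := by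
  have h : (k : ℝ) ≤ 2 ^ k := by exact_mod_cast Nat.lt_two_pow_self.le
  calc _ = (k : ℝ) * (((i + 2 * k).choose k : ℝ) * z ^ k) := by ring
    _ ≤ (2 : ℝ) ^ k * (2 ^ i * (4 * z) ^ k) :=
      mul_le_mul h (choose_mul_pow_le hz i k) (by positivity) (by positivity)
    _ = _ := by rw [mul_left_comm, ← mul_pow]; ring_nf

variable {t z : ℝ}

lemma hasSum_choose_mul_pow (ht : 0 ≤ t) (ht' : t ≤ 1 / 4) (hz : z = t ^ 2 / (1 + t ^ 2) ^ 2)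
    (i : ℕ) : HasSum (fun k : ℕ ↦ ((i + 2 * k).choose k : ℝ) * z ^ k)
      ((1 + t ^ 2) ^ i * ((1 + t ^ 2) / (1 - t ^ 2))) ∧
    HasSum (fun k : ℕ ↦ (k : ℝ) * (i + 2 * k).choose k * z ^ k)
      ((1 + t ^ 2) ^ i * (i * (t ^ 2 * (1 + t ^ 2)) / (1 - t ^ 2) ^ 2 +
        2 * t ^ 2 * (1 + t ^ 2) / (1 - t ^ 2) ^ 3)) := by
  have ht2 : t ^ 2 ≤ 1 / 16 := by nlinarith
  have h1 : 0 < 1 - t ^ 2 := by linarith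
  have hz0 : 0 ≤ z := by rw [hz]; positivity
  have hz8 : 8 * z ≤ 1 / 2 := by
    rw [hz]
    have : t ^ 2 / (1 + t ^ 2) ^ 2 ≤ t ^ 2 := by
      apply div_le_self (by positivity)
      nlinarith [sq_nonneg t]
    linarith
  have hsf : ∀ i, Summable (fun k : ℕ ↦ ((i + 2 * k).choose k : ℝ) * z ^ k) := fun i ↦
    Summable.of_nonneg_of_le (fun k ↦ by positivity) (choose_mul_pow_le hz0 i)
      ((summable_geometric_of_lt_one (by positivity) (by linarith)).mul_left _)
  have hsg : ∀ i, Summable (fun k : ℕ ↦ (k : ℝ) * (i + 2 * k).choose k * z ^ k) := fun i ↦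
    Summable.of_nonneg_of_le (fun k ↦ by positivity) (mul_choose_mul_pow_le hz0 i)
      ((summable_geometric_of_lt_one (by positivity) (by linarith)).mul_left _)
  set f : ℕ → ℝ := fun i ↦ ∑' k : ℕ, ((i + 2 * k).choose k : ℝ) * z ^ k with hf
  set g : ℕ → ℝ := fun i ↦ ∑' k : ℕ, (k : ℝ) * (i + 2 * k).choose k * z ^ k with hg
  have hcent : ∀ k : ℕ, ((0 + 2 * (k + 1)).choose (k + 1) : ℝ) = 2 * (1 + 2 * k).choose k := by
    intro k
    rw [show 0 + 2 * (k + 1) = 2 * k + 1 + 1 by ring, Nat.choose_succ_succ,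
      Nat.choose_symm_half, show 1 + 2 * k = 2 * k + 1 by ring]
    push_cast
    ring
  have hpascal : ∀ i k : ℕ, ((i + 1 + 2 * (k + 1)).choose (k + 1) : ℝ) =
      (i + 2 + 2 * k).choose k + (i + 2 * (k + 1)).choose (k + 1) := by
    intro i k
    rw [show i + 1 + 2 * (k + 1) = i + 2 + 2 * k + 1 by ring, Nat.choose_succ_succ,
      show i + 2 * (k + 1) = i + 2 + 2 * k by ring]
    push_cast
    rfl
  have hfs : ∀ i, f i = 1 + ∑' k : ℕ, ((i + 2 * (k + 1)).choose (k + 1) : ℝ) * z ^ (k + 1) := by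
    intro i
    simp only [hf]
    rw [(hsf i).tsum_eq_zero_add]
    simp
  have hgs : ∀ i, g i = ∑' k : ℕ,
      ((k + 1 : ℕ) : ℝ) * (i + 2 * (k + 1)).choose (k + 1) * z ^ (k + 1) := by
    intro i
    simp only [hg]
    rw [(hsg i).tsum_eq_zero_add]
    simp
  have hsf' := fun i ↦ (summable_nat_add_iff 1).mpr (hsf i)
  have hsg' := fun i ↦ (summable_nat_add_iff 1).mpr (hsg i)
  have hf0 : f 0 = 1 + 2 * z * f 1 := by
    rw [hfs 0, hf, ← tsum_mul_left]
    congr 2 with k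
    rw [hcent, pow_succ]
    ring
  have hfrec : ∀ i, f (i + 1) = f i + z * f (i + 2) := by
    intro i
    rw [hfs (i + 1), hfs i, hf, ← tsum_mul_left, add_assoc,
      ← (hsf' i).tsum_add ((hsf (i + 2)).mul_left z)]
    congr 2 with k
    rw [hpascal, pow_succ]
    ring
  have hg0 : g 0 = 2 * z * (g 1 + f 1) := by
    rw [hgs 0, hf, hg, ← (hsg 1).tsum_add (hsf 1), ← tsum_mul_left]
    congr 1 with k
    rw [hcent, pow_succ]
    push_cast
    ring
  have hgrec : ∀ i, g (i + 1) = g i + z * (g (i + 2) + f (i + 2)) := by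
    intro i
    rw [hgs (i + 1), hgs i, hf, hg, ← (hsg (i + 2)).tsum_add (hsf (i + 2)), ← tsum_mul_left,
      ← (hsg' i).tsum_add (((hsg (i + 2)).add (hsf (i + 2))).mul_left z)]
    congr 1 with k
    rw [hpascal, pow_succ]
    push_cast
    ring
  have hfle : ∀ i, |f i| ≤ 2 * 3 ^ i := by
    intro i
    rw [abs_of_nonneg (tsum_nonneg fun k ↦ by positivity)]
    have h2 : HasSum (fun k : ℕ ↦ (2 : ℝ) ^ i * (4 * z) ^ k) (2 ^ i * (1 - 4 * z)⁻¹) :=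
      (hasSum_geometric_of_lt_one (by positivity) (by linarith)).mul_left _
    refine ((hsf i).tsum_le_tsum (choose_mul_pow_le hz0 i) h2.summable).trans ?_
    rw [h2.tsum_eq, mul_comm]
    gcongr
    · exact inv_le_of_inv_le₀ (by norm_num) (by linarith)
    · norm_num
  have hgle : ∀ i, |g i| ≤ 2 * 3 ^ i := by
    intro i
    rw [abs_of_nonneg (tsum_nonneg fun k ↦ by positivity)]
    have h2 : HasSum (fun k : ℕ ↦ (2 : ℝ) ^ i * (8 * z) ^ k) (2 ^ i * (1 - 8 * z)⁻¹) :=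
      (hasSum_geometric_of_lt_one (by positivity) (by linarith)).mul_left _
    refine ((hsg i).tsum_le_tsum (mul_choose_mul_pow_le hz0 i) h2.summable).trans ?_
    rw [h2.tsum_eq, mul_comm]
    gcongr
    · exact inv_le_of_inv_le₀ (by norm_num) (by linarith)
    · norm_num
  have hzC : z * (1 + t ^ 2) ^ 2 = 1 + t ^ 2 - 1 := by
    rw [hz]
    field_simp
    ring
  have h3 : 3 * (z * (1 + t ^ 2)) < 1 := by nlinarith
  have hfe : ∀ i, f i = (1 + t ^ 2) ^ i * ((1 + t ^ 2) / (1 - t ^ 2)) := by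
    intro i
    refine sub_eq_zero.mp (eq_zero_of_recurrence (K := 4)
      (x := fun i ↦ f i - (1 + t ^ 2) ^ i * ((1 + t ^ 2) / (1 - t ^ 2))) hz0 (by positivity)
      hzC h3 ?_ ?_ ?_ i)
    · intro i
      refine (abs_sub _ _).trans ?_
      rw [abs_of_nonneg (a := (1 + t ^ 2) ^ i * _) (by positivity)]
      have h4 : (1 + t ^ 2) / (1 - t ^ 2) ≤ 2 := by
        rw [div_le_iff₀ h1]
        linarith
      have h5 : (1 + t ^ 2) ^ i ≤ 3 ^ i := by
        gcongr
        linarith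
      nlinarith [hfle i, mul_le_mul h5 h4 (by positivity) (by positivity)]
    · intro i
      simp only [hfrec i, hz]
      field_simp
      ring
    · simp only [hf0, hz]
      field_simp
      ring
  have hge : ∀ i, g i = (1 + t ^ 2) ^ i * (i * (t ^ 2 * (1 + t ^ 2)) / (1 - t ^ 2) ^ 2 +
        2 * t ^ 2 * (1 + t ^ 2) / (1 - t ^ 2) ^ 3) := by
    intro i
    refine sub_eq_zero.mp (eq_zero_of_recurrence (K := 4)
      (x := fun i ↦ g i - (1 + t ^ 2) ^ i * (i * (t ^ 2 * (1 + t ^ 2)) / (1 - t ^ 2) ^ 2 +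
        2 * t ^ 2 * (1 + t ^ 2) / (1 - t ^ 2) ^ 3)) hz0 (by positivity)
      hzC h3 ?_ ?_ ?_ i)
    · intro i
      refine (abs_sub _ _).trans ?_
      rw [abs_of_nonneg (a := (1 + t ^ 2) ^ i * _) (by positivity)]
      have h4 : t ^ 2 * (1 + t ^ 2) / (1 - t ^ 2) ^ 2 ≤ 1 := by
        rw [div_le_one (by positivity)]
        nlinarith [sq_nonneg t]
      have h5 : 2 * t ^ 2 * (1 + t ^ 2) / (1 - t ^ 2) ^ 3 ≤ 1 := by
        have h7 : (15 / 16 : ℝ) ^ 3 ≤ (1 - t ^ 2) ^ 3 := by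
          gcongr
          linarith
        rw [div_le_one (by positivity)]
        nlinarith [sq_nonneg t]
      have h6 : (1 + t ^ 2) ^ i * (i + 1) ≤ 3 ^ i := by
        have h8 : (i : ℝ) + 1 ≤ 2 ^ i := by exact_mod_cast Nat.lt_two_pow_self
        calc _ ≤ (3 / 2 : ℝ) ^ i * 2 ^ i := by
              gcongr
              linarith
          _ = _ := by rw [← mul_pow]; norm_num
      have h9 : (1 + t ^ 2) ^ i * (i * (t ^ 2 * (1 + t ^ 2)) / (1 - t ^ 2) ^ 2 +
          2 * t ^ 2 * (1 + t ^ 2) / (1 - t ^ 2) ^ 3) ≤ (1 + t ^ 2) ^ i * (i + 1) := by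
        gcongr
        rw [mul_div_assoc]
        exact mul_le_of_le_one_right (by positivity) h4
      have h10 : (0 : ℝ) ≤ 3 ^ i := by positivity
      linarith [hgle i]
    · intro i
      simp only [hgrec i, hfe, hz]
      push_cast
      field_simp
      ring
    · simp only [hg0, hfe, hz]
      push_cast
      field_simp
      ring
  exact ⟨hfe i ▸ (hsf i).hasSum, hge i ▸ (hsg i).hasSum⟩

end BinomialSeries

section DoubleSeries

/-- The weights of the double series that defines the coefficients `c m`. -/
noncomputable def coeffWeight (A : ℝ) (i k : ℕ) : ℝ :=
  ((i + 2 * k).choose k : ℝ) * (i + k) * A ^ i / i.factorial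

/-- The sum of the weights along `i + 2 * k = j`. -/
noncomputable def coeffSum (A : ℝ) (j : ℕ) : ℝ :=
  ∑ k ∈ range (j / 2 + 1), coeffWeight A (j - 2 * k) k

lemma coeffWeight_nonneg {A : ℝ} (hA : 0 ≤ A) (i k : ℕ) : 0 ≤ coeffWeight A i k := by
  unfold coeffWeight
  positivity

lemma coeffSum_nonneg {A : ℝ} (hA : 0 ≤ A) (j : ℕ) : 0 ≤ coeffSum A j :=
  sum_nonneg fun _ _ ↦ coeffWeight_nonneg hA _ _

lemma coeffWeight_succ_left_le {A : ℝ} (hA : 0 ≤ A) {i k : ℕ} (h : 1 ≤ i + k) :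
    coeffWeight A (i + 1) k ≤ 3 * A * coeffWeight A i k := by
  have h1 : ((i + 1 + 2 * k).choose k : ℝ) * (i + 1 + k) =
      (i + 2 * k).choose k * (i + 1 + 2 * k) := by
    have := Nat.choose_mul_succ_eq (i + 2 * k) k
    rw [show i + 2 * k + 1 - k = i + 1 + k by omega, show i + 2 * k + 1 = i + 1 + 2 * k by ring]
      at this
    exact_mod_cast this.symm
  have h2 : ((i : ℝ) + 1 + 2 * k) ≤ 3 * (i + k) * (i + 1) := by
    have : (1 : ℝ) ≤ i + k := by exact_mod_cast h
    nlinarith [Nat.cast_nonneg (α := ℝ) i, Nat.cast_nonneg (α := ℝ) k]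
  unfold coeffWeight
  rw [Nat.factorial_succ]
  push_cast
  rw [h1, div_le_iff₀ (by positivity)]
  calc _ = ((i + 2 * k).choose k : ℝ) * A ^ (i + 1) * (i + 1 + 2 * k) := by ring
    _ ≤ ((i + 2 * k).choose k : ℝ) * A ^ (i + 1) * (3 * (i + k) * (i + 1)) := by gcongr
    _ = _ := by field_simp; ring

lemma coeffWeight_zero_succ {A : ℝ} (hA : A ≠ 0) (k : ℕ) :
    coeffWeight A 0 (k + 1) = 2 / A * coeffWeight A 1 k := by
  unfold coeffWeight
  rw [show 0 + 2 * (k + 1) = 2 * k + 1 + 1 by ring, Nat.choose_succ_succ,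
    Nat.choose_symm_half, show 1 + 2 * k = 2 * k + 1 by ring]
  push_cast
  field_simp
  simp
  ring

lemma coeffSum_succ_le {A : ℝ} (hA : 0 < A) {j : ℕ} (hj : 1 ≤ j) :
    coeffSum A (j + 1) ≤ (3 * A + 2 / A) * coeffSum A j := by
  have h1 : ∑ k ∈ range (j / 2 + 1), coeffWeight A (j + 1 - 2 * k) k ≤ 3 * A * coeffSum A j := by
    rw [coeffSum, mul_sum]
    refine sum_le_sum fun k hk ↦ ?_
    rw [mem_range] at hk
    rw [show j + 1 - 2 * k = j - 2 * k + 1 by omega]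
    exact coeffWeight_succ_left_le hA.le (by omega)
  rw [add_mul]
  rcases Nat.even_or_odd' j with ⟨l, rfl | rfl⟩
  · rw [coeffSum, show (2 * l + 1) / 2 = 2 * l / 2 by omega]
    have := coeffSum_nonneg hA.le (2 * l)
    have : 0 ≤ 2 / A * coeffSum A (2 * l) := by positivity
    linarith
  · rw [coeffSum, show (2 * l + 1 + 1) / 2 = (2 * l + 1) / 2 + 1 by omega, sum_range_succ]
    refine add_le_add h1 ?_
    rw [show (2 * l + 1) / 2 = l by omega, show 2 * l + 1 + 1 - 2 * (l + 1) = 0 by omega,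
      coeffWeight_zero_succ hA.ne']
    gcongr
    rw [coeffSum, show (2 * l + 1) / 2 = l by omega]
    have := single_le_sum (f := fun k ↦ coeffWeight A (2 * l + 1 - 2 * k) k)
      (fun k _ ↦ coeffWeight_nonneg hA.le _ k) (self_mem_range_succ l)
    simpa [show 2 * l + 1 - 2 * l = 1 by omega] using this

lemma antitone_pow_mul_coeffSum {A v : ℝ} (hA : 0 < A) (hv : 0 ≤ v)
    (hvA : v * (3 * A + 2 / A) ≤ 1) : Antitone fun m ↦ v ^ m * coeffSum A (m + 1) := by
  refine antitone_nat_of_succ_le fun m ↦ ?_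
  calc v ^ (m + 1) * coeffSum A (m + 1 + 1)
      ≤ v ^ (m + 1) * ((3 * A + 2 / A) * coeffSum A (m + 1)) := by
        gcongr
        exact coeffSum_succ_le hA (by omega)
    _ = v * (3 * A + 2 / A) * (v ^ m * coeffSum A (m + 1)) := by ring
    _ ≤ _ := mul_le_of_le_one_left (mul_nonneg (by positivity) (coeffSum_nonneg hA.le _)) hvA

lemma summable_coeffWeight {A v : ℝ} (hA : 0 ≤ A) (hv : 0 ≤ v) (hv' : 8 * v ^ 2 < 1) :
    Summable fun x : ℕ × ℕ ↦ (-v) ^ (x.1 + 2 * x.2) * coeffWeight A x.1 x.2 := by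
  have h1 : Summable fun i : ℕ ↦ (4 * A * v) ^ i / i.factorial :=
    Real.summable_pow_div_factorial _
  have h2 : Summable fun k : ℕ ↦ (8 * v ^ 2) ^ k :=
    summable_geometric_of_lt_one (by positivity) hv'
  refine Summable.of_norm_bounded
    (h1.mul_of_nonneg h2 (fun i ↦ by positivity) fun k ↦ by positivity) ?_
  rintro ⟨i, k⟩
  dsimp only
  rw [norm_mul, norm_pow, norm_neg, norm_of_nonneg hv,
    norm_of_nonneg (coeffWeight_nonneg hA _ _), coeffWeight]
  have h3 : (i + k : ℝ) ≤ 2 ^ (i + k) := by exact_mod_cast Nat.lt_two_pow_self.le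
  calc v ^ (i + 2 * k) * (((i + 2 * k).choose k : ℝ) * (i + k) * A ^ i / i.factorial)
      = ((i + 2 * k).choose k : ℝ) * (v ^ 2) ^ k * (i + k) * ((A * v) ^ i / i.factorial) := by
        rw [pow_add, pow_mul, mul_pow]
        ring
    _ ≤ 2 ^ i * (4 * v ^ 2) ^ k * 2 ^ (i + k) * ((A * v) ^ i / i.factorial) := by
        gcongr ?_ * ?_ * _
        exact choose_mul_pow_le (sq_nonneg v) i k
    _ = (2 * 2 * (A * v)) ^ i / i.factorial * (2 * (4 * v ^ 2)) ^ k := by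
        rw [pow_add, mul_pow _ (A * v), mul_pow 2 2, mul_pow 2 (4 * v ^ 2)]
        ring
    _ = _ := by ring_nf

variable {t A v : ℝ}

lemma hasSum_coeffWeight (hA : 0 ≤ A) (ht : 0 ≤ t) (ht' : t ≤ 1 / 4) (hv : v = t / (1 + t ^ 2)) :
    HasSum (fun x : ℕ × ℕ ↦ (-v) ^ (x.1 + 2 * x.2) * coeffWeight A x.1 x.2)
      (exp (-(A * t)) * (-(A * t) * (1 + t ^ 2) / (1 - t ^ 2) ^ 2 +
        2 * t ^ 2 * (1 + t ^ 2) / (1 - t ^ 2) ^ 3)) := by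
  have ht2 : t ^ 2 ≤ 1 / 16 := by nlinarith
  have h1 : 0 < 1 - t ^ 2 := by linarith
  have hv0 : 0 ≤ v := by rw [hv]; positivity
  have hvt : v ≤ t := by
    rw [hv]
    exact div_le_self ht (by nlinarith [sq_nonneg t])
  have hs := summable_coeffWeight hA hv0 (by nlinarith : 8 * v ^ 2 < 1)
  have hrow : ∀ i : ℕ, HasSum (fun k : ℕ ↦ (-v) ^ (i + 2 * k) * coeffWeight A i k)
      ((-(A * t)) ^ i / i.factorial * (i * ((1 + t ^ 2) / (1 - t ^ 2) ^ 2) +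
        2 * t ^ 2 * (1 + t ^ 2) / (1 - t ^ 2) ^ 3)) := by
    intro i
    obtain ⟨hf, hg⟩ := hasSum_choose_mul_pow ht ht' (z := v ^ 2) (by rw [hv, div_pow]) i
    have h2 : (-(A * t)) ^ i / i.factorial * (i * ((1 + t ^ 2) / (1 - t ^ 2) ^ 2) +
        2 * t ^ 2 * (1 + t ^ 2) / (1 - t ^ 2) ^ 3) = (-(A * v)) ^ i / i.factorial *
        (i * ((1 + t ^ 2) ^ i * ((1 + t ^ 2) / (1 - t ^ 2))) + (1 + t ^ 2) ^ i *
          (i * (t ^ 2 * (1 + t ^ 2)) / (1 - t ^ 2) ^ 2 +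
            2 * t ^ 2 * (1 + t ^ 2) / (1 - t ^ 2) ^ 3)) := by
      rw [show -(A * t) = -(A * v) * (1 + t ^ 2) by rw [hv]; field_simp, mul_pow]
      field_simp
      ring
    rw [h2]
    refine (((hf.mul_left (i : ℝ)).add hg).mul_left ((-(A * v)) ^ i / i.factorial)).congr_fun
      fun k ↦ ?_
    rw [coeffWeight, pow_add, pow_mul (-v), neg_sq, ← mul_neg, mul_pow A]
    ring
  have h2 := hs.hasSum.prod_fiberwise hrow
  have hexp : HasSum (fun i : ℕ ↦ (-(A * t)) ^ i / i.factorial) (exp (-(A * t))) := by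
    rw [Real.exp_eq_exp_ℝ]
    exact NormedSpace.expSeries_div_hasSum_exp _
  have hexp' : HasSum (fun i : ℕ ↦ (-(A * t)) ^ i / i.factorial * i)
      (-(A * t) * exp (-(A * t))) := by
    rw [← hasSum_nat_add_iff' 1]
    rw [sum_range_one, Nat.cast_zero, mul_zero, sub_zero]
    refine (hexp.mul_left (-(A * t))).congr_fun fun i ↦ ?_
    rw [Nat.factorial_succ, pow_succ]
    push_cast
    field_simp
  have h3 := (hexp'.mul_right ((1 + t ^ 2) / (1 - t ^ 2) ^ 2)).add
    (hexp.mul_right (2 * t ^ 2 * (1 + t ^ 2) / (1 - t ^ 2) ^ 3))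
  have h4 : ∑' x : ℕ × ℕ, (-v) ^ (x.1 + 2 * x.2) * coeffWeight A x.1 x.2 = _ :=
    h2.unique (h3.congr_fun fun i ↦ by ring)
  convert hs.hasSum using 1
  rw [h4]
  ring

lemma hasSum_coeffSum (hA : 0 ≤ A) (ht : 0 ≤ t) (ht' : t ≤ 1 / 4) (hv : v = t / (1 + t ^ 2)) :
    HasSum (fun j : ℕ ↦ (-v) ^ j * coeffSum A j)
      (exp (-(A * t)) * (-(A * t) * (1 + t ^ 2) / (1 - t ^ 2) ^ 2 +
        2 * t ^ 2 * (1 + t ^ 2) / (1 - t ^ 2) ^ 3)) := by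
  have hinj : Function.Injective fun x : ℕ × ℕ ↦ (x.1 + 2 * x.2, x.2) := by
    rintro ⟨a, b⟩ ⟨a', b'⟩ h
    simp only [Prod.mk.injEq] at h ⊢
    omega
  let T : ℕ × ℕ → ℝ := fun x ↦
    if 2 * x.2 ≤ x.1 then (-v) ^ x.1 * coeffWeight A (x.1 - 2 * x.2) x.2 else 0
  have h1 : HasSum T _ := (hinj.hasSum_iff (by
    rintro ⟨j, k⟩ hx
    refine if_neg fun hjk ↦ hx ⟨(j - 2 * k, k), ?_⟩
    simp only [Prod.mk.injEq, and_true]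
    dsimp only at hjk
    omega)).mp ((hasSum_coeffWeight hA ht ht' hv).congr_fun fun x ↦ by simp [T])
  refine h1.prod_fiberwise fun j ↦ ?_
  have h2 : (-v) ^ j * coeffSum A j = ∑ k ∈ range (j / 2 + 1), T (j, k) := by
    rw [coeffSum, mul_sum]
    refine sum_congr rfl fun k hk ↦ ?_
    rw [mem_range] at hk
    simp only [T]
    rw [if_pos (by omega)]
  rw [h2]
  refine hasSum_sum_of_ne_finset_zero fun k hk ↦ ?_
  rw [mem_range] at hk
  exact if_neg (by dsimp only; omega)

end DoubleSeries

section Enveloping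

lemma c_eq_coeffSum (m : ℕ) :
    c m = (-1) ^ m / (4 * √6) ^ m * (coeffSum (π / 6) (m + 1) / (π / 6)) := by
  rw [c, coeffSum, sum_div]
  congr 1
  refine sum_congr rfl fun k hk ↦ ?_
  rw [mem_range] at hk
  have hA : π / 6 ≠ 0 := by positivity
  rw [coeffWeight, show m + 1 - 2 * k + 2 * k = m + 1 by omega,
    show (m : ℤ) - 2 * k = ((m + 1 - 2 * k : ℕ) : ℤ) - 1 by omega, zpow_sub_one₀ hA, zpow_natCast,
    show ((m + 1 - k : ℕ) : ℝ) = ((m + 1 - 2 * k : ℕ) : ℝ) + k by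
      rw [← Nat.cast_add]
      congr 1
      omega]
  field_simp

lemma c_div_rpow (n m : ℕ) :
    c m / (n : ℝ) ^ ((m : ℝ) / 2) =
      (-1) ^ m * ((4 * √6 * √n)⁻¹ ^ m * coeffSum (π / 6) (m + 1) / (π / 6)) := by
  have h : (n : ℝ) ^ ((m : ℝ) / 2) = √n ^ m := by
    rw [sqrt_eq_rpow, ← rpow_mul_natCast (Nat.cast_nonneg n)]
    congr 1
    ring
  rw [h, c_eq_coeffSum, inv_pow, mul_pow (4 * √6)]
  ring

/-- The partial sums of the expansion envelop the main term of the partition function. -/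
lemma expansion_enveloping {n : ℕ} {μ : ℝ} (hn : 1 ≤ n) (hμ0 : 0 < μ)
    (hμ : (n : ℝ) - 1 / 24 = 3 * μ ^ 2 / (2 * π ^ 2)) (N : ℕ) :
    c (2 * N + 1) / (n : ℝ) ^ ((N : ℝ) + 1 / 2) ≤
      4 * √3 * n * exp (-(π * √(2 * n / 3))) * (π ^ 2 / (6 * √3 * μ ^ 2) * (1 - 1 / μ) * exp μ) -
        ∑ m ∈ range (2 * N + 1), c m / (n : ℝ) ^ ((m : ℝ) / 2) ∧
    4 * √3 * n * exp (-(π * √(2 * n / 3))) * (π ^ 2 / (6 * √3 * μ ^ 2) * (1 - 1 / μ) * exp μ) ≤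
        ∑ m ∈ range (2 * N + 1), c m / (n : ℝ) ^ ((m : ℝ) / 2) := by
  have hn' : (1 : ℝ) ≤ n := by exact_mod_cast hn
  obtain ⟨r, hr⟩ : ∃ r, r = 6 * μ / π := ⟨_, rfl⟩
  obtain ⟨q, hq⟩ : ∃ q, q = √(24 * n) := ⟨_, rfl⟩
  have hr0 : 0 < r := by rw [hr]; positivity
  have hq0 : 0 < q := by rw [hq]; positivity
  have hq2 : q ^ 2 = 24 * n := by rw [hq, sq_sqrt (by positivity)]
  have hr2 : r ^ 2 = 24 * n - 1 := by
    have : μ = π * r / 6 := by rw [hr]; field_simp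
    rw [this] at hμ
    field_simp at hμ
    linarith
  have hμr : μ = π / 6 * r := by rw [hr]; field_simp
  have hq4 : 4 ≤ q := by nlinarith
  obtain ⟨t, ht⟩ : ∃ t, t = (q + r)⁻¹ := ⟨_, rfl⟩
  have ht0 : 0 < t := by rw [ht]; positivity
  have ht4 : t ≤ 1 / 4 := by
    rw [ht, one_div]
    exact inv_anti₀ (by norm_num) (by linarith)
  have htm : t * (q + r) = 1 := by rw [ht]; exact inv_mul_cancel₀ (by positivity)
  have hts : t = q - r := by
    have : (q - r) * (q + r) = 1 := by linarith
    calc t = t * ((q - r) * (q + r)) := by rw [this, mul_one]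
      _ = t * (q + r) * (q - r) := by ring
      _ = _ := by rw [htm, one_mul]
  have h1 : 1 + t ^ 2 = 2 * q * t := by linear_combination t * hts - htm
  have h2 : 1 - t ^ 2 = 2 * r * t := by linear_combination -t * hts - htm
  obtain ⟨v, hv⟩ : ∃ v, v = (4 * √6 * √n)⁻¹ := ⟨_, rfl⟩
  have hvq : v = (2 * q)⁻¹ := by
    rw [hv, hq, show (24 : ℝ) * n = 2 ^ 2 * (6 * n) by ring, sqrt_mul (by positivity),
      sqrt_sq (by norm_num), sqrt_mul (by norm_num)]
    ring
  have hv0 : 0 < v := by rw [hvq]; positivity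
  have hvt : v = t / (1 + t ^ 2) := by
    rw [hvq, h1]
    field_simp
  have hA : 0 < π / 6 := by positivity
  have hanti := antitone_pow_mul_coeffSum hA hv0.le (by
    have hv8 : v ≤ 1 / 8 := by
      rw [hvq, one_div]
      exact inv_anti₀ (by norm_num) (by linarith)
    have h3 : 2 / (π / 6) ≤ 4 := by
      rw [div_le_iff₀ hA]
      linarith [pi_gt_three]
    nlinarith [pi_lt_four])
  have hanti' : Antitone fun m ↦ v ^ m * coeffSum (π / 6) (m + 1) / (π / 6) := fun a b hab ↦
    div_le_div_of_nonneg_right (hanti hab) hA.le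
  have hsum : HasSum (fun m ↦ (-1) ^ m * (v ^ m * coeffSum (π / 6) (m + 1) / (π / 6)))
      (4 * √3 * n * exp (-(π * √(2 * n / 3))) *
        (π ^ 2 / (6 * √3 * μ ^ 2) * (1 - 1 / μ) * exp μ)) := by
    have h3 := (hasSum_nat_add_iff' 1).mpr (hasSum_coeffSum hA.le ht0.le ht4 hvt)
    have h4 : coeffSum (π / 6) 0 = 0 := by simp [coeffSum, coeffWeight]
    rw [sum_range_one, h4, mul_zero, sub_zero] at h3
    have h5 : √(2 * n / 3) = q / 6 := by
      rw [sqrt_eq_iff_mul_self_eq (by positivity) (by positivity)]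
      linarith
    have h6 : exp (-(π * √(2 * n / 3))) * exp μ = exp (-(π / 6 * t)) := by
      rw [← exp_add, h5, hμr, hts]
      ring_nf
    have h7 : 4 * √3 * n * exp (-(π * √(2 * n / 3))) *
        (π ^ 2 / (6 * √3 * μ ^ 2) * (1 - 1 / μ) * exp μ) =
        (-(v * (π / 6)))⁻¹ * (exp (-(π / 6 * t)) *
          (-(π / 6 * t) * (1 + t ^ 2) / (1 - t ^ 2) ^ 2 +
            2 * t ^ 2 * (1 + t ^ 2) / (1 - t ^ 2) ^ 3)) := by
      rw [h1, h2, hvq, ← h6, hμr, show (n : ℝ) = q ^ 2 / 24 by linarith]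
      field_simp
      ring
    rw [h7]
    refine (h3.mul_left _).congr_fun fun m ↦ ?_
    rw [pow_succ, neg_pow v m]
    field_simp
  have hlim := hsum.tendsto_sum_nat
  simp only [c_div_rpow n, ← hv]
  constructor
  · have h8 := hanti'.alternating_series_le_tendsto hlim (N + 1)
    rw [show 2 * (N + 1) = 2 * N + 1 + 1 by ring, sum_range_succ] at h8
    have h9 := c_div_rpow n (2 * N + 1)
    rw [show ((2 * N + 1 : ℕ) : ℝ) / 2 = N + 1 / 2 by push_cast; ring, ← hv] at h9
    rw [h9]
    linarith
  · exact hanti'.tendsto_le_alternating_series hlim N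

end Enveloping

section Computation

/-- Function application, arranged so that the kernel evaluates the argument first. -/
def evalThen {α : Type*} (x : ℕ) (f : ℕ → α) : α :=
  match x with
  | 0 => f 0
  | y + 1 => f (y + 1)

lemma evalThen_eq {α : Type*} (x : ℕ) (f : ℕ → α) : evalThen x f = f x := by
  cases x <;> rfl

/-- The scale of the fixed-point arithmetic. -/
def fixScale : ℕ := 2 ^ 192

/-- `k` steps of Newton's iteration for the square root of `a`. -/
def newtonSqrt (a : ℕ) : ℕ → ℕ → ℕ
  | 0, x => x
  | k + 1, x => evalThen ((x + a / x) / 2) (newtonSqrt a k)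

/-- `k` squarings in fixed-point arithmetic, rounded down. -/
def squareDown : ℕ → ℕ → ℕ
  | 0, y => y
  | k + 1, y => evalThen (y * y / fixScale) (squareDown k)

/-- `k` squarings in fixed-point arithmetic, rounded up. -/
def squareUp : ℕ → ℕ → ℕ
  | 0, y => y
  | k + 1, y => evalThen (y * y / fixScale + 1) (squareUp k)

/-- A lower bound for `exp (2 ^ 32 * a)` in fixed-point arithmetic. -/
def expDown (a : ℕ) : ℕ :=
  squareDown 32 (fixScale + a + a ^ 2 / (2 * fixScale) + a ^ 3 / (6 * fixScale ^ 2))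

/-- An upper bound for `exp (2 ^ 32 * a)` in fixed-point arithmetic. -/
def expUp (a : ℕ) : ℕ :=
  squareUp 32 (fixScale + a + (a ^ 2 / (2 * fixScale) + 1) + (a ^ 3 / (6 * fixScale ^ 2) + 1) +
    (a ^ 4 / (16 * fixScale ^ 3) + 1))

/-- Verification of an estimate for `P`, given an approximation `x` of the square root of
`24 * n - 1`, a lower bound `e` and an upper bound `f` for the exponential in question. -/
def checkBounds (n P x e f : ℕ) : Bool :=
  evalThen (6 * fixScale ^ 2 * 10 ^ 20 / (314159265358979323846 * (x - 1)) + 1) fun u ↦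
  evalThen (6 * fixScale ^ 2 * 10 ^ 20 / (314159265358979323847 * (x + 1))) fun l ↦
  Nat.ble ((x - 1) ^ 2) ((24 * n - 1) * fixScale ^ 2) &&
  Nat.ble ((24 * n - 1) * fixScale ^ 2) ((x + 1) ^ 2) &&
  Nat.blt (24 * n * (P * (24 * n - 1) * 288675134594812882255 * fixScale ^ 3 + u * f ^ 2 * 10 ^ 21))
    ((24 * n * e ^ 2 * fixScale + e * (24 * n - 1) * fixScale ^ 2) * 10 ^ 21) &&
  Nat.blt (24 * n * f ^ 2 * fixScale * 10 ^ 21)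
    (24 * n * (P * (24 * n - 1) * 288675134594812882254 * fixScale ^ 3 + l * e ^ 2 * 10 ^ 21) +
      e * (24 * n - 1) * fixScale ^ 2 * 10 ^ 21)

/-- Verification of the estimate for the number `P` of partitions of `n`. -/
def checkValue (n P : ℕ) : Bool :=
  evalThen (newtonSqrt ((24 * n - 1) * fixScale ^ 2) 14 (150 * fixScale)) fun x ↦
  evalThen (314159265358979323846 * (x - 1) / (12 * 10 ^ 20 * 2 ^ 32)) fun a ↦
  evalThen (314159265358979323847 * (x + 1) / (12 * 10 ^ 20 * 2 ^ 32) + 1) fun b ↦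
  evalThen (expDown a) fun e ↦ evalThen (expUp b) (checkBounds n P x e)

/-- Verification of the estimates for `k` consecutive values, which are the digits of `Q`. -/
def checkAll (B : ℕ) : ℕ → ℕ → ℕ → Bool
  | 0, _, _ => true
  | k + 1, n, Q => checkValue n (Q % B) &&
    evalThen (n + 1) fun m ↦ evalThen (Q / B) (checkAll B k m)

/-- Multiplication by `∑ i, B ^ (s * i)` modulo `B ^ M`, by repeated doubling. -/
def mulGeometric (B M : ℕ) : ℕ → ℕ → ℕ → ℕ
  | 0, _, x => x
  | r + 1, s, x =>
    if M ≤ s then x else evalThen ((x + x * B ^ s) % B ^ M) (mulGeometric B M r (2 * s))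

/-- The number `x * ∏ i < k, (1 - B ^ (i + 1))⁻¹` modulo `B ^ M`. For `x = 1` and `k = M - 1` this is
`∑ j < M, (number of partitions of j) * B ^ j`. -/
def packedPartitions (B M r : ℕ) : ℕ → ℕ → ℕ
  | 0, x => x
  | k + 1, x => evalThen (mulGeometric B M r (k + 1) x) (packedPartitions B M r k)

lemma checkAll_packedPartitions : evalThen (packedPartitions (2 ^ 128) 855 10 854 1 / 2 ^ 128)
    (checkAll (2 ^ 128) 854 1) = true := by
  decide +kernel

end Computation

section ComputationSound

lemma fixScale_pos : (0 : ℝ) < fixScale := by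
  norm_num [fixScale]

lemma div_mul_le (a b : ℕ) : ((a / b : ℕ) : ℝ) * b ≤ a := by
  exact_mod_cast Nat.div_mul_le_self a b

lemma le_div_add_one_mul (a : ℕ) {b : ℕ} (hb : 0 < b) : (a : ℝ) ≤ ((a / b : ℕ) + 1) * b := by
  exact_mod_cast (Nat.lt_mul_of_div_lt (Nat.lt_succ_self (a / b)) hb).le

lemma squareDown_le {s : ℝ} (k : ℕ) {y : ℕ} (hy : y ≤ fixScale * exp s) :
    squareDown k y ≤ fixScale * exp (2 ^ k * s) := by
  induction k generalizing s y with
  | zero => simpa [squareDown] using hy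
  | succ k ih =>
    rw [squareDown, evalThen_eq, pow_succ, mul_assoc]
    refine ih (le_of_mul_le_mul_right ((div_mul_le _ _).trans ?_) fixScale_pos)
    push_cast
    calc (y : ℝ) * y ≤ fixScale * exp s * (fixScale * exp s) := by gcongr
      _ = _ := by rw [two_mul, exp_add]; ring

lemma le_squareUp {s : ℝ} (k : ℕ) {y : ℕ} (hy : fixScale * exp s ≤ y) :
    fixScale * exp (2 ^ k * s) ≤ squareUp k y := by
  induction k generalizing s y with
  | zero => simpa [squareUp] using hy
  | succ k ih =>
    rw [squareUp, evalThen_eq, pow_succ, mul_assoc]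
    refine ih (le_of_mul_le_mul_right ?_ fixScale_pos)
    have h := le_div_add_one_mul (y * y) (b := fixScale) (by norm_num [fixScale])
    push_cast at h ⊢
    calc fixScale * exp (2 * s) * fixScale = fixScale * exp s * (fixScale * exp s) := by
          rw [two_mul, exp_add]; ring
      _ ≤ (y : ℝ) * y := by gcongr
      _ ≤ _ := h

lemma expDown_le {a : ℕ} {s : ℝ} (h : 2 ^ 32 * (a : ℝ) ≤ fixScale * s) :
    expDown a ≤ fixScale * exp s := by
  have hD := fixScale_pos
  have h1 : (fixScale + a + a ^ 2 / (2 * fixScale) + a ^ 3 / (6 * fixScale ^ 2) : ℕ) ≤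
      fixScale * exp (a / fixScale) := by
    have h2 := sum_le_exp_of_nonneg (x := (a : ℝ) / fixScale) (by positivity) 4
    simp only [sum_range_succ, range_zero, sum_empty, Nat.factorial] at h2
    have h3 := div_mul_le (a ^ 2) (2 * fixScale)
    have h4 := div_mul_le (a ^ 3) (6 * fixScale ^ 2)
    push_cast at h2 h3 h4 ⊢
    rw [← le_div_iff₀ (by positivity)] at h3 h4
    calc _ ≤ (fixScale : ℝ) + a + a ^ 2 / (2 * fixScale) + a ^ 3 / (6 * fixScale ^ 2) := by gcongr
      _ = fixScale * (0 + (a / fixScale : ℝ) ^ 0 / 1 + (a / fixScale) ^ 1 / (1 * 1) +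
          (a / fixScale) ^ 2 / (2 * (1 * 1)) + (a / fixScale) ^ 3 / (3 * (2 * (1 * 1)))) := by
        field_simp
        ring
      _ ≤ _ := by
        gcongr
        refine le_trans (le_of_eq ?_) h2
        norm_num
  refine (squareDown_le 32 h1).trans ?_
  gcongr
  rw [← mul_div_assoc, div_le_iff₀ hD]
  linarith

lemma le_expUp {b : ℕ} {s : ℝ} (h : fixScale * s ≤ 2 ^ 32 * (b : ℝ)) (hb : b ≤ fixScale) :
    fixScale * exp s ≤ expUp b := by
  have hD := fixScale_pos
  have h1 : fixScale * exp (b / fixScale) ≤ (fixScale + b + (b ^ 2 / (2 * fixScale) + 1) +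
      (b ^ 3 / (6 * fixScale ^ 2) + 1) + (b ^ 4 / (16 * fixScale ^ 3) + 1) : ℕ) := by
    have h2 := exp_bound' (x := (b : ℝ) / fixScale) (by positivity)
      (by rw [div_le_one hD]; exact_mod_cast hb) (n := 4) (by norm_num)
    simp only [sum_range_succ, range_zero, sum_empty, Nat.factorial] at h2
    have hp : 0 < fixScale := by exact_mod_cast hD
    have h3 := le_div_add_one_mul (b ^ 2) (b := 2 * fixScale) (by positivity)
    have h4 := le_div_add_one_mul (b ^ 3) (b := 6 * fixScale ^ 2) (by positivity)
    have h5 := le_div_add_one_mul (b ^ 4) (b := 16 * fixScale ^ 3) (by positivity)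
    push_cast at h2 h3 h4 h5 ⊢
    rw [← div_le_iff₀ (by positivity)] at h3 h4 h5
    calc _ ≤ fixScale * (0 + (b / fixScale : ℝ) ^ 0 / 1 + (b / fixScale) ^ 1 / (1 * 1) +
          (b / fixScale) ^ 2 / (2 * (1 * 1)) + (b / fixScale) ^ 3 / (3 * (2 * (1 * 1))) +
          (b / fixScale) ^ 4 / 16) := by
          gcongr
          refine h2.trans ?_
          norm_num
          have : (0 : ℝ) ≤ (b / fixScale) ^ 4 := by positivity
          linarith
      _ = (fixScale : ℝ) + b + b ^ 2 / (2 * fixScale) + b ^ 3 / (6 * fixScale ^ 2) +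
          b ^ 4 / (16 * fixScale ^ 3) := by
        field_simp
        ring
      _ ≤ _ := by gcongr
  refine le_trans ?_ (le_squareUp 32 h1)
  gcongr
  rw [← mul_div_assoc, le_div_iff₀ hD]
  linarith

lemma sqrt_three_div_six_mem : 288675134594812882254 / 10 ^ 21 ≤ √3 / 6 ∧
    √3 / 6 ≤ 288675134594812882255 / 10 ^ 21 := by
  constructor
  · rw [le_div_iff₀ (by norm_num)]
    exact le_sqrt_of_sq_le (by norm_num)
  · rw [div_le_iff₀ (by norm_num)]
    exact sqrt_le_iff.mpr ⟨by norm_num, by norm_num⟩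

lemma abs_sub_lt_of_checkBounds {n P x e f : ℕ} {μ : ℝ} (hn : 1 ≤ n)
    (hμ : μ = π * √(24 * n - 1) / 6) (he : e ≤ fixScale * exp (μ / 2))
    (hf : fixScale * exp (μ / 2) ≤ f) (hx : ((x - 1 : ℕ) : ℝ) ≤ √(24 * n - 1) * fixScale)
    (hx' : √(24 * n - 1) * fixScale ≤ x + 1) (h1x : 0 < x - 1)
    (h : checkBounds n P x e f = true) :
    |P - π ^ 2 / (6 * √3 * μ ^ 2) * (1 - 1 / μ) * exp μ| < exp (μ / 2) / (4 * √3 * n) := by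
  have hD := fixScale_pos
  have hn' : (1 : ℝ) ≤ n := by exact_mod_cast hn
  obtain ⟨w, hw⟩ : ∃ w : ℝ, w = 24 * n - 1 := ⟨_, rfl⟩
  have hw0 : 0 < w := by rw [hw]; linarith
  have hwn : ((24 * n - 1 : ℕ) : ℝ) = w := by
    rw [hw, Nat.cast_sub (by omega)]
    push_cast
    rfl
  rw [← hw] at hμ hx hx'
  have hμ0 : 0 < μ := by rw [hμ]; positivity
  simp only [checkBounds, evalThen_eq, Bool.and_eq_true, Nat.ble_eq, Nat.blt_eq] at h
  obtain ⟨⟨-, h1⟩, h2⟩ := h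
  set u := 6 * fixScale ^ 2 * 10 ^ 20 / (314159265358979323846 * (x - 1)) + 1 with hu
  set l := 6 * fixScale ^ 2 * 10 ^ 20 / (314159265358979323847 * (x + 1)) with hl
  have hu' : fixScale * (1 / μ) ≤ u := by
    have h3 := le_div_add_one_mul (6 * fixScale ^ 2 * 10 ^ 20)
      (b := 314159265358979323846 * (x - 1)) (by positivity)
    have h4 := pi_gt_d20
    rw [← Nat.cast_add_one, ← hu] at h3
    push_cast at h3
    rw [mul_one_div, div_le_iff₀ hμ0]
    have h5 : ((314159265358979323846 : ℝ) / 10 ^ 20) * (x - 1 : ℕ) ≤ 6 * μ * fixScale := by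
      calc _ ≤ π * (√w * fixScale) := by
            gcongr
            norm_num at h4 ⊢
            exact h4.le
        _ = _ := by rw [hμ]; ring
    have h6 : u * ((314159265358979323846 / 10 ^ 20) * ((x - 1 : ℕ) : ℝ)) ≤
        u * (6 * μ * fixScale) := by gcongr
    refine le_of_mul_le_mul_right ?_ hD
    linarith
  have hl' : l ≤ fixScale * (1 / μ) := by
    have h3 := div_mul_le (6 * fixScale ^ 2 * 10 ^ 20) (314159265358979323847 * (x + 1))
    have h4 := pi_lt_d20
    rw [← hl] at h3
    push_cast at h3
    rw [mul_one_div, le_div_iff₀ hμ0]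
    have h5 : 6 * μ * fixScale ≤ ((314159265358979323847 : ℝ) / 10 ^ 20) * (x + 1) := by
      calc _ = π * (√w * fixScale) := by rw [hμ]; ring
        _ ≤ _ := by
            gcongr
            norm_num at h4 ⊢
            exact h4.le
    have h6 : (l : ℝ) * (6 * μ * fixScale) ≤
        l * ((314159265358979323847 / 10 ^ 20) * (x + 1)) := by gcongr
    refine le_of_mul_le_mul_right ?_ hD
    linarith
  obtain ⟨E, hE⟩ : ∃ E, E = exp (μ / 2) := ⟨_, rfl⟩
  have hE0 : 0 < E := by rw [hE]; positivity
  have hE2 : exp μ = E ^ 2 := by rw [hE, ← exp_nat_mul]; congr 1; push_cast; ring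
  obtain ⟨S, hS⟩ : ∃ S, S = √3 / 6 := ⟨_, rfl⟩
  obtain ⟨m, hm⟩ : ∃ m, m = 1 / μ := ⟨_, rfl⟩
  have hm0 : 0 < m := by rw [hm]; positivity
  obtain ⟨hS1, hS2⟩ := sqrt_three_div_six_mem
  rw [← hS] at hS1 hS2
  rw [← hE] at he hf ⊢
  rw [← hm] at hu' hl'
  have hc : (0 : ℝ) < 24 * n := by positivity
  have k1 : 24 * n * (P * w * S + m * E ^ 2) < 24 * n * E ^ 2 + E * w := by
    have h4 : (24 * n * (P * w * 288675134594812882255 * fixScale ^ 3 + u * f ^ 2 * 10 ^ 21) : ℝ) <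
        (24 * n * e ^ 2 * fixScale + e * w * fixScale ^ 2) * 10 ^ 21 := by
      rw [← hwn]
      exact_mod_cast h1
    refine lt_of_mul_lt_mul_right ?_ (by positivity : (0 : ℝ) ≤ 10 ^ 21 * fixScale ^ 3)
    calc 24 * n * (P * w * S + m * E ^ 2) * (10 ^ 21 * fixScale ^ 3)
        = 24 * n * (P * w * (S * 10 ^ 21) * fixScale ^ 3 +
          (fixScale * m) * (fixScale * E) ^ 2 * 10 ^ 21) := by ring
      _ ≤ (24 * n * (P * w * 288675134594812882255 * fixScale ^ 3 + u * f ^ 2 * 10 ^ 21) : ℝ) := by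
        gcongr
        exact (le_div_iff₀ (by positivity)).mp hS2
      _ < _ := h4
      _ ≤ (24 * n * (fixScale * E) ^ 2 * fixScale + (fixScale * E) * w * fixScale ^ 2) *
          10 ^ 21 := by gcongr
      _ = _ := by ring
  have k2 : 24 * n * E ^ 2 < 24 * n * (P * w * S + m * E ^ 2) + E * w := by
    have h4 : (24 * n * f ^ 2 * fixScale * 10 ^ 21 : ℝ) <
        24 * n * (P * w * 288675134594812882254 * fixScale ^ 3 + l * e ^ 2 * 10 ^ 21) +
          e * w * fixScale ^ 2 * 10 ^ 21 := by
      rw [← hwn]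
      exact_mod_cast h2
    refine lt_of_mul_lt_mul_right ?_ (by positivity : (0 : ℝ) ≤ 10 ^ 21 * fixScale ^ 3)
    calc 24 * n * E ^ 2 * (10 ^ 21 * fixScale ^ 3)
        = 24 * n * (fixScale * E) ^ 2 * fixScale * 10 ^ 21 := by ring
      _ ≤ (24 * n * f ^ 2 * fixScale * 10 ^ 21 : ℝ) := by gcongr
      _ < _ := h4
      _ ≤ 24 * n * (P * w * (S * 10 ^ 21) * fixScale ^ 3 +
          (fixScale * m) * (fixScale * E) ^ 2 * 10 ^ 21) +
          (fixScale * E) * w * fixScale ^ 2 * 10 ^ 21 := by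
        gcongr
        exact (div_le_iff₀ (by positivity)).mp hS1
      _ = _ := by ring
  have hmain : π ^ 2 / (6 * √3 * μ ^ 2) = 1 / (w * S) := by
    rw [hμ, hS]
    field_simp
    rw [sq_sqrt hw0.le]
  have hS0 : 0 < S := by rw [hS]; positivity
  have hR : E / (4 * √3 * n) = E * w / (24 * n * (w * S)) := by
    rw [hS]
    field_simp
    norm_num
  rw [hmain, hE2, hR, ← hm, show (P : ℝ) - 1 / (w * S) * (1 - m) * E ^ 2 =
    24 * n * (P * w * S + m * E ^ 2 - E ^ 2) / (24 * n * (w * S)) by field_simp; ring, abs_div,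
    abs_of_pos (by positivity : 0 < 24 * n * (w * S))]
  gcongr
  rw [abs_lt]
  constructor <;> linarith

lemma abs_sub_lt_of_checkValue {n P : ℕ} {μ : ℝ} (hn : 1 ≤ n) (hn' : n ≤ 1000)
    (hμ : μ = π * √(24 * n - 1) / 6) (h : checkValue n P = true) :
    |P - π ^ 2 / (6 * √3 * μ ^ 2) * (1 - 1 / μ) * exp μ| < exp (μ / 2) / (4 * √3 * n) := by
  have hD := fixScale_pos
  simp only [checkValue, evalThen_eq] at h
  set x := newtonSqrt ((24 * n - 1) * fixScale ^ 2) 14 (150 * fixScale) with hx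
  have h' := h
  simp only [checkBounds, evalThen_eq, Bool.and_eq_true, Nat.ble_eq, Nat.blt_eq] at h'
  obtain ⟨⟨⟨h1, h2⟩, -⟩, -⟩ := h'
  clear_value x
  have hn1 : (1 : ℝ) ≤ n := by exact_mod_cast hn
  have hw0 : (0 : ℝ) < 24 * n - 1 := by linarith
  have hwn : ((24 * n - 1 : ℕ) : ℝ) = 24 * n - 1 := by
    rw [Nat.cast_sub (by omega)]
    push_cast
    rfl
  have hwD : √((24 * n - 1) * fixScale ^ 2) = √(24 * n - 1) * fixScale := by
    rw [sqrt_mul hw0.le, sqrt_sq hD.le]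
  have hx1 : ((x - 1 : ℕ) : ℝ) ≤ √(24 * n - 1) * fixScale := by
    rw [← hwD, ← hwn]
    exact le_sqrt_of_sq_le (by exact_mod_cast h1)
  have hx2 : √(24 * n - 1) * fixScale ≤ x + 1 := by
    rw [← hwD, ← hwn]
    exact sqrt_le_iff.mpr ⟨by positivity, by exact_mod_cast h2⟩
  have hx0 : 0 < x - 1 := by
    have : (4 : ℝ) ≤ x + 1 := by
      refine le_trans ?_ hx2
      have h3 : (1 : ℝ) ≤ √(24 * n - 1) := one_le_sqrt.mpr (by linarith)
      have h4 : (4 : ℝ) ≤ fixScale := by norm_num [fixScale]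
      nlinarith
    have : 4 ≤ x + 1 := by exact_mod_cast this
    omega
  have hx3 : x ≤ 160 * fixScale := by
    have h3 : √(24 * n - 1) ≤ 159 := by
      refine sqrt_le_iff.mpr ⟨by norm_num, ?_⟩
      have : (n : ℝ) ≤ 1000 := by exact_mod_cast hn'
      linarith
    have h4 : ((x - 1 : ℕ) : ℝ) ≤ 159 * fixScale := hx1.trans (by gcongr)
    have h5 : x - 1 ≤ 159 * fixScale := by exact_mod_cast h4
    have h6 : 1 ≤ fixScale := by norm_num [fixScale]
    omega
  refine abs_sub_lt_of_checkBounds hn hμ (expDown_le ?_) (le_expUp ?_ ?_) hx1 hx2 hx0 h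
  · have h3 := div_mul_le (314159265358979323846 * (x - 1)) (12 * 10 ^ 20 * 2 ^ 32)
    set a := 314159265358979323846 * (x - 1) / (12 * 10 ^ 20 * 2 ^ 32)
    have h4 := pi_gt_d20
    push_cast at h3
    have h5 : ((314159265358979323846 : ℝ) / 10 ^ 20) * (x - 1 : ℕ) ≤
        π * (√(24 * n - 1) * fixScale) := by
      gcongr
      norm_num at h4 ⊢
      exact h4.le
    rw [hμ]
    linarith
  · have h3 := le_div_add_one_mul (314159265358979323847 * (x + 1))
      (b := 12 * 10 ^ 20 * 2 ^ 32) (by norm_num)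
    rw [← Nat.cast_add_one] at h3
    set b := 314159265358979323847 * (x + 1) / (12 * 10 ^ 20 * 2 ^ 32) + 1
    have h4 := pi_lt_d20
    push_cast at h3
    have h5 : π * (√(24 * n - 1) * fixScale) ≤
        ((314159265358979323847 : ℝ) / 10 ^ 20) * (x + 1) := by
      gcongr
      norm_num at h4 ⊢
      exact h4.le
    rw [hμ]
    linarith
  · have h3 : 314159265358979323847 * (x + 1) / (12 * 10 ^ 20 * 2 ^ 32) < fixScale := by
      rw [Nat.div_lt_iff_lt_mul (by norm_num)]
      have h6 : 1 ≤ fixScale := by norm_num [fixScale]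
      omega
    exact h3

end ComputationSound

section PackedPartitions

open PowerSeries in
lemma coeff_prod_one_sub_X_pow {A : Type*} [CommRing A] {n K : ℕ} (h : n ≤ K) :
    coeff n (∏ i ∈ range K, (1 - X ^ (i + 1) : A⟦X⟧)) = coeff n (pentagonalSeries A) := by
  obtain ⟨s, hs⟩ := (tendsto_finset_range.eventually
    (coeff_prod_one_sub_X_pow_eventually_eq A n)).exists_forall_of_atTop
  have key : ∀ j, coeff n (∏ i ∈ range (K + j), (1 - X ^ (i + 1) : A⟦X⟧)) =
      coeff n (∏ i ∈ range K, (1 - X ^ (i + 1) : A⟦X⟧)) := by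
    intro j
    induction j with
    | zero => rfl
    | succ j ih =>
      rw [← add_assoc, prod_range_succ, mul_sub, mul_one, map_sub, ih, coeff_mul_X_pow',
        if_neg (by omega), sub_zero]
  rw [← key s, hs _ (by omega)]

/-- The generating function of the partitions, evaluated at a nilpotent element. -/
lemma sum_card_partition_mul_prod {A : Type*} [CommRing A] {b : A} {M K : ℕ} (hb : b ^ M = 0)
    (hK : M ≤ K + 1) :
    (∑ j ∈ range M, (Fintype.card (Nat.Partition j) : A) * b ^ j) *
      ∏ i ∈ range K, (1 - b ^ (i + 1)) = 1 := by
  set f : PowerSeries A := PowerSeries.mk fun n ↦ (Fintype.card (Nat.Partition n) : A) with hf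
  set g : Polynomial A := ∏ i ∈ range K, (1 - Polynomial.X ^ (i + 1)) with hg
  have hd : (Polynomial.X : Polynomial A) ^ M ∣ PowerSeries.trunc M f * g - 1 := by
    rw [Polynomial.X_pow_dvd_iff]
    intro d hd
    have hgc : (g : PowerSeries A) = ∏ i ∈ range K, (1 - PowerSeries.X ^ (i + 1)) := by
      rw [hg, ← Polynomial.coeToPowerSeries.ringHom_apply, map_prod]
      simp
    have h1 : Polynomial.coeff (PowerSeries.trunc M f * g) d =
        PowerSeries.coeff d (f * PowerSeries.pentagonalSeries A) := by
      rw [Polynomial.coeff_mul, PowerSeries.coeff_mul]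
      refine sum_congr rfl fun x hx ↦ ?_
      rw [HasAntidiagonal.mem_antidiagonal] at hx
      rw [PowerSeries.coeff_trunc, if_pos (by omega), ← Polynomial.coeff_coe, hgc,
        coeff_prod_one_sub_X_pow (by omega)]
    rw [Polynomial.coeff_sub, h1, mk_card_partition_mul_pentagonalSeries, PowerSeries.coeff_one,
      Polynomial.coeff_one, sub_self]
  obtain ⟨q, hq⟩ := hd
  have := congrArg (Polynomial.eval b) hq
  simp only [Polynomial.eval_sub, Polynomial.eval_mul, Polynomial.eval_pow, Polynomial.eval_X, hb,
    zero_mul, Polynomial.eval_one, hg, Polynomial.eval_prod] at this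
  rw [← sub_eq_zero, ← this, Polynomial.eval, PowerSeries.eval₂_trunc_eq_sum_range]
  simp [hf]

lemma natCast_mulGeometric {B M : ℕ} (r s x : ℕ) (h : M ≤ s * 2 ^ r) :
    ∃ g : ZMod (B ^ M), (mulGeometric B M r s x : ZMod (B ^ M)) = x * g ∧
      g * (1 - (B : ZMod (B ^ M)) ^ s) = 1 := by
  have hB : (B : ZMod (B ^ M)) ^ M = 0 := by rw [← Nat.cast_pow, ZMod.natCast_self]
  induction r generalizing s x with
  | zero =>
    exact ⟨1, by simp [mulGeometric], by simp [pow_eq_zero_of_le (by simpa using h) hB]⟩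
  | succ r ih =>
    by_cases hs : M ≤ s
    · exact ⟨1, by simp [mulGeometric, hs], by simp [pow_eq_zero_of_le hs hB]⟩
    · obtain ⟨g, h1, h2⟩ := ih (2 * s) ((x + x * B ^ s) % B ^ M) (by rw [pow_succ] at h; linarith)
      refine ⟨(1 + (B : ZMod (B ^ M)) ^ s) * g, ?_, ?_⟩
      · rw [mulGeometric, if_neg hs, evalThen_eq, h1, ZMod.natCast_mod]
        push_cast
        ring
      · rw [two_mul, pow_add] at h2
        linear_combination h2

lemma natCast_packedPartitions_mul {B M r : ℕ} (k x : ℕ) (h : M ≤ 2 ^ r) :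
    (packedPartitions B M r k x : ZMod (B ^ M)) *
      ∏ i ∈ range k, (1 - (B : ZMod (B ^ M)) ^ (i + 1)) = x := by
  induction k generalizing x with
  | zero => simp [packedPartitions]
  | succ k ih =>
    obtain ⟨g, h1, h2⟩ := natCast_mulGeometric (B := B) r (k + 1) x
      (h.trans (Nat.le_mul_of_pos_left _ k.succ_pos))
    have h3 := ih (mulGeometric B M r (k + 1) x)
    rw [packedPartitions, evalThen_eq, prod_range_succ, ← mul_assoc, h3, h1, mul_assoc, h2, mul_one]

lemma packedPartitions_modEq {B M r K : ℕ} (h : M ≤ 2 ^ r) (hK : M ≤ K + 1) :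
    packedPartitions B M r K 1 ≡ ∑ j ∈ range M, Fintype.card (Nat.Partition j) * B ^ j
      [MOD B ^ M] := by
  have hB : (B : ZMod (B ^ M)) ^ M = 0 := by rw [← Nat.cast_pow, ZMod.natCast_self]
  have h1 := natCast_packedPartitions_mul (B := B) K 1 h
  have h2 := sum_card_partition_mul_prod hB hK
  rw [← ZMod.natCast_eq_natCast_iff]
  push_cast
  rw [Nat.cast_one] at h1
  linear_combination (packedPartitions B M r K 1 : ZMod (B ^ M)) * (-h2) +
    (∑ j ∈ range M, (Fintype.card (Nat.Partition j) : ZMod (B ^ M)) * (B : ZMod (B ^ M)) ^ j) * h1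

lemma sum_mul_pow_div_mod {B M n : ℕ} {a : ℕ → ℕ} (ha : ∀ j < M, a j < B) (hn : n < M) :
    (∑ j ∈ range M, a j * B ^ j) / B ^ n % B = a n := by
  have hlt : ∀ k ≤ M, ∑ j ∈ range k, a j * B ^ j < B ^ k := by
    intro k hk
    induction k with
    | zero => simp
    | succ k ih =>
      rw [sum_range_succ, pow_succ']
      have := ih (by omega)
      have := Nat.mul_le_mul_right (B ^ k) (ha k (by omega))
      rw [Nat.succ_mul] at this
      omega
  have hB : 0 < B := (Nat.zero_le _).trans_lt (ha n hn)
  have hsplit : ∑ j ∈ range M, a j * B ^ j = (∑ j ∈ range n, a j * B ^ j) +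
      B ^ n * (a n + B * ∑ j ∈ range (M - (n + 1)), a (n + 1 + j) * B ^ j) := by
    rw [show M = n + 1 + (M - (n + 1)) by omega, sum_range_add, sum_range_succ, mul_add, mul_sum,
      mul_sum, show n + 1 + (M - (n + 1)) - (n + 1) = M - (n + 1) by omega, add_assoc]
    congr 2
    · ring
    · exact sum_congr rfl fun j _ ↦ by ring
  rw [hsplit, Nat.add_mul_div_left _ _ (pow_pos hB n), Nat.div_eq_of_lt (hlt n hn.le), zero_add,
    Nat.add_mul_mod_self_left, Nat.mod_eq_of_lt (ha n hn)]

lemma packedPartitions_div_mod {B M r K n : ℕ} (h : M ≤ 2 ^ r) (hK : M ≤ K + 1)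
    (hB : ∀ j < M, Fintype.card (Nat.Partition j) < B) (hn : n < M) :
    packedPartitions B M r K 1 / B ^ n % B = Fintype.card (Nat.Partition n) := by
  have h1 := sum_mul_pow_div_mod hB hn
  have h2 : ∀ x : ℕ, x % B ^ M / B ^ n % B = x / B ^ n % B := by
    intro x
    obtain ⟨d, rfl⟩ : ∃ d, M = n + 1 + d := ⟨M - (n + 1), by omega⟩
    rw [← Nat.mod_mul_right_div_self, ← Nat.mod_mul_right_div_self, ← pow_succ,
      Nat.mod_mod_of_dvd _ (pow_dvd_pow B (by omega))]
  rw [← h1, ← h2, ← h2 (∑ j ∈ range M, _), packedPartitions_modEq h hK]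

lemma checkValue_of_checkAll {B : ℕ} : ∀ {k n Q : ℕ}, checkAll B k n Q = true →
    ∀ i < k, checkValue (n + i) (Q / B ^ i % B) = true
  | 0, _, _, _, _, hi => by omega
  | k + 1, n, Q, h, i, hi => by
    rw [checkAll, Bool.and_eq_true, evalThen_eq, evalThen_eq] at h
    rcases i with _ | i
    · simpa using h.1
    · have := checkValue_of_checkAll h.2 i (by omega)
      rwa [Nat.div_div_eq_div_mul, ← pow_succ', add_right_comm, add_assoc] at this

lemma card_partition_mono : Monotone fun n ↦ Fintype.card (Nat.Partition n) := by
  refine monotone_nat_of_le_succ fun n ↦ ?_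
  refine Fintype.card_le_of_injective (fun q : Nat.Partition n ↦ (⟨1 ::ₘ q.parts, ?_, ?_⟩ :
    Nat.Partition (n + 1))) ?_
  · intro i hi
    rcases Multiset.mem_cons.1 hi with rfl | hi
    · exact one_pos
    · exact q.parts_pos hi
  · rw [Multiset.sum_cons, q.parts_sum, add_comm]
  · intro q q' h
    exact Nat.Partition.ext ((Multiset.cons_inj_right 1).1 (congrArg Nat.Partition.parts h))

end PackedPartitions

section Remainder

lemma card_partition_lt_two_pow {j : ℕ} (hj : j ≤ 860) :
    Fintype.card (Nat.Partition j) < 2 ^ 128 := by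
  refine (card_partition_mono hj).trans_lt ?_
  set μ : ℝ := π * √(24 * 860 - 1) / 6 with hμ
  have hs : √(24 * 860 - 1 : ℝ) ^ 2 = 24 * 860 - 1 := Real.sq_sqrt (by norm_num)
  have h1 : (143.6 : ℝ) ≤ √(24 * 860 - 1) := Real.le_sqrt_of_sq_le (by norm_num)
  have h2 : √(24 * 860 - 1 : ℝ) ≤ 144 := by
    rw [Real.sqrt_le_left (by norm_num)]
    norm_num
  have hπ := pi_gt_d2
  have hπ' := pi_lt_d2
  have h75 : 75 ≤ μ := by rw [hμ]; nlinarith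
  have h76 : μ ≤ 76 := by
    have : π * √(24 * 860 - 1) ≤ 3.15 * 144 := by gcongr
    rw [hμ]
    linarith
  have key := abs_p_sub_le (n := 860) h75 (by
    rw [hμ, div_pow, mul_pow, hs]
    field_simp
    norm_num)
  have e1 : π ^ 2 / (6 * √3 * μ ^ 2) * (1 - 1 / μ) ≤ 1 := by
    have h3 : 1 ≤ √3 := by rw [Real.one_le_sqrt]; norm_num
    have : π ^ 2 / (6 * √3 * μ ^ 2) ≤ 1 := by
      rw [div_le_one (by positivity)]
      nlinarith
    have h4 : 1 - 1 / μ ≤ 1 := by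
      have : 0 ≤ 1 / μ := by positivity
      linarith
    have h5 : 0 ≤ 1 - 1 / μ := by
      rw [sub_nonneg, div_le_one (by positivity)]
      linarith
    exact mul_le_one₀ this h5 h4
  have e2 : 0.93 * exp (μ / 2) / μ ^ 2 ≤ exp μ := by
    rw [div_le_iff₀ (by positivity)]
    have : exp (μ / 2) ≤ exp μ := exp_le_exp.2 (by linarith)
    have h1 : 1 ≤ μ ^ 2 := by nlinarith
    have := mul_le_mul_of_nonneg_left h1 (exp_pos μ).le
    linarith [exp_pos μ]
  have e3 : exp μ ≤ 2.7182818286 ^ 76 := by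
    calc exp μ ≤ exp ((76 : ℕ) * 1) := exp_le_exp.2 (by push_cast; linarith)
      _ = exp 1 ^ 76 := by rw [exp_nat_mul]
      _ ≤ _ := by gcongr; exact exp_one_lt_d9.le
  have e4 := (abs_le.1 key).2
  have e5 := mul_le_mul_of_nonneg_right e1 (exp_pos μ).le
  have : p 860 < 2 ^ 128 := by
    have : (2 : ℝ) * 2.7182818286 ^ 76 < 2 ^ 128 := by norm_num
    linarith
  unfold p at this
  exact_mod_cast this

lemma checkValue_card_partition {n : ℕ} (hn : 1 ≤ n) (hn' : n ≤ 854) :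
    checkValue n (Fintype.card (Nat.Partition n)) = true := by
  have h := checkAll_packedPartitions
  rw [evalThen_eq] at h
  have := checkValue_of_checkAll h (n - 1) (by omega)
  rwa [Nat.div_div_eq_div_mul, ← pow_succ', show 1 + (n - 1) = n by omega,
    show n - 1 + 1 = n by omega, packedPartitions_div_mod (by norm_num) (by norm_num)
      (fun j hj ↦ card_partition_lt_two_pow (by omega)) (by omega)] at this

lemma abs_p_sub_lt {n : ℕ} {μ : ℝ} (hn : 1 ≤ n) (hμ : μ = π * √(24 * n - 1) / 6) :
    |p n - π ^ 2 / (6 * √3 * μ ^ 2) * (1 - 1 / μ) * exp μ| < exp (μ / 2) / (4 * √3 * n) := by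
  have hn1 : (1 : ℝ) ≤ n := by exact_mod_cast hn
  have hs : √(24 * n - 1 : ℝ) ^ 2 = 24 * n - 1 := Real.sq_sqrt (by linarith)
  have hμ2 : μ ^ 2 = π ^ 2 * (24 * n - 1) / 36 := by
    rw [hμ, div_pow, mul_pow, hs]
    norm_num
  have hπ := pi_gt_d6
  rcases le_or_gt 75 μ with h75 | h75
  · refine (abs_p_sub_le h75 ?_).trans_lt ?_
    · rw [hμ2]
      field_simp
      ring
    · have h3 : √3 < 1.7321 := by
        rw [Real.sqrt_lt' (by norm_num)]
        norm_num
      rw [div_lt_div_iff₀ (by positivity) (by positivity)]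
      have : 0.93 * (4 * √3 * n) < μ ^ 2 := by
        have hn4 : (4 : ℝ) ≤ n := by
          have hπ4 : π ^ 2 ≤ 16 := by nlinarith [pi_le_four, pi_pos]
          nlinarith
        have : (0.93 * 4 * 1.7321 : ℝ) * n < 9.8 * (24 * n - 1) / 36 := by linarith
        have hπ2 : 9.8 ≤ π ^ 2 := by nlinarith
        rw [hμ2]
        nlinarith
      calc 0.93 * exp (μ / 2) * (4 * √3 * n) = exp (μ / 2) * (0.93 * (4 * √3 * n)) := by ring
        _ < exp (μ / 2) * μ ^ 2 := by gcongr
  · have hn' : n ≤ 854 := by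
      by_contra! h
      have h' : (855 : ℝ) ≤ n := by exact_mod_cast h
      have hμ0 : 0 ≤ μ := by rw [hμ]; positivity
      nlinarith [mul_lt_mul'' h75 h75 hμ0 hμ0, mul_lt_mul'' hπ hπ (by norm_num) (by norm_num)]
    exact abs_sub_lt_of_checkValue hn (by omega) hμ (checkValue_card_partition hn hn')

end Remainder

theorem stmt8 (N n : ℕ) (hn : 1 ≤ n) :
    c (2 * N + 1) / (n : ℝ) ^ ((N : ℝ) + 1 / 2) -
        Real.exp (-(π / 2 * Real.sqrt (2 * n / 3))) < R (2 * N + 1) n ∧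
      R (2 * N + 1) n < Real.exp (-(π / 2 * Real.sqrt (2 * n / 3))) := by
  have hn1 : (1 : ℝ) ≤ n := by exact_mod_cast hn
  obtain ⟨μ, hμ⟩ : ∃ μ, μ = π * √(24 * n - 1) / 6 := ⟨_, rfl⟩
  have hμ0 : 0 < μ := by
    have := Real.sqrt_pos.2 (show (0 : ℝ) < 24 * n - 1 by linarith)
    rw [hμ]
    positivity
  have hμ2 : (n : ℝ) - 1 / 24 = 3 * μ ^ 2 / (2 * π ^ 2) := by
    rw [hμ, div_pow, mul_pow, Real.sq_sqrt (by linarith)]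
    field_simp
    ring
  have hle : μ ≤ π * √(2 * n / 3) := by
    have : √(24 * n - 1) / 6 ≤ √(2 * n / 3 : ℝ) := by
      refine Real.le_sqrt_of_sq_le ?_
      rw [div_pow, Real.sq_sqrt (by linarith)]
      linarith
    rw [hμ, mul_div_assoc]
    exact mul_le_mul_of_nonneg_left this pi_pos.le
  obtain ⟨h1, h2⟩ := expansion_enveloping hn hμ0 hμ2 N
  have h3 := abs_p_sub_lt hn hμ
  set T := π ^ 2 / (6 * √3 * μ ^ 2) * (1 - 1 / μ) * exp μ
  set x := π * √(2 * n / 3)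
  have h4 : 4 * √3 * n * exp (-x) * |p n - T| < exp (-(π / 2 * √(2 * n / 3))) := by
    calc 4 * √3 * n * exp (-x) * |p n - T|
        < 4 * √3 * n * exp (-x) * (exp (μ / 2) / (4 * √3 * n)) := by gcongr
      _ = exp (-x + μ / 2) := by
        rw [exp_add]
        field_simp
      _ ≤ _ := by
        refine exp_le_exp.2 ?_
        have : π / 2 * √(2 * n / 3) = x / 2 := by ring
        linarith
  rw [← abs_of_pos (show 0 < 4 * √3 * n * exp (-x) by positivity), ← abs_mul, abs_lt, mul_sub] at h4
  rw [R]
  constructor <;> linarith
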